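/- For all integers n ≥ 1 and d ≥ 1 there exists a constant c = c(n,d) > 0 such that for every r > 0 and every C^d function f : B^n_r → ℝ on the closed ball of radius r in ℝ^n, the following two bounds hold for the set Δ(f) = f({x ∈ B^n_r : ∇f(x) = 0}) of critical values of f: (i) for every ε ≥ R_d(f), the covering number satisfies M(ε, Δ(f)) ≤ c; (ii) for every ε with 0 < ε ≤ R_d(f), M(ε, Δ(f)) ≤ c · (R_d(f)/ε)^{n/d}. -/

import Mathlib

open Metric Set

/-- The covering number `M(ε, S)`: the minimal number of closed intervals of
radius `ε` needed to cover `S ⊆ ℝ`. -/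
noncomputable def coveringNumber (ε : ℝ) (S : Set ℝ) : ℕ :=
  sInf {N : ℕ | ∃ t : Finset ℝ, t.card = N ∧ S ⊆ ⋃ c ∈ t, Metric.closedBall c ε}

/-- The Taylor constant `R_d(f) = (r^d/d!) · sup_{x ∈ B^n_r} ‖D^d f(x)‖`. -/
noncomputable def taylorConst (n d : ℕ) (r : ℝ) (f : EuclideanSpace ℝ (Fin n) → ℝ) : ℝ :=
  (r ^ d / d.factorial) *
    ⨆ x ∈ closedBall (0 : EuclideanSpace ℝ (Fin n)) r,
      ‖iteratedFDerivWithin ℝ d f (closedBall (0 : EuclideanSpace ℝ (Fin n)) r) x‖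

open MvPolynomial in
theorem MvPolynomial.hasFDerivAt_eval {n : ℕ} (F : MvPolynomial (Fin n) ℝ) (x : Fin n → ℝ) :
    HasFDerivAt (fun y => eval y F)
      (∑ i, eval x (pderiv i F) • ContinuousLinearMap.proj (R := ℝ) (φ := fun _ : Fin n => ℝ) i)
      x := by
  induction F using MvPolynomial.induction_on with
  | C a => simpa using hasFDerivAt_const a x
  | add p q hp hq =>
    simp only [map_add, add_smul, Finset.sum_add_distrib]
    exact hp.add hq
  | mul_X p j hp =>
    have h := hp.mul (hasFDerivAt_apply (𝕜 := ℝ) j x)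
    simp only [map_mul, eval_X]
    refine h.congr_fderiv ?_
    ext v
    simp [pderiv_X, Pi.single_apply, add_mul, Finset.sum_add_distrib, Finset.mul_sum, apply_ite]
    ring_nf

open MvPolynomial in
theorem MvPolynomial.totalDegree_pderiv_le {n : ℕ} (F : MvPolynomial (Fin n) ℝ) (i : Fin n) :
    (pderiv i F).totalDegree ≤ F.totalDegree := by
  conv_lhs => rw [F.as_sum, map_sum]
  refine totalDegree_finsetSum_le fun s hs => ?_
  rw [pderiv_monomial]
  refine (totalDegree_monomial_le _ _).trans ?_
  refine le_trans ?_ (le_totalDegree hs)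
  exact Finsupp.sum_le_sum_index tsub_le_self (fun _ _ => monotone_id) (fun _ _ => rfl)

open MvPolynomial in
theorem MvPolynomial.totalDegree_bind₁_le {σ τ : Type*} (G : σ → MvPolynomial τ ℝ)
    (F : MvPolynomial σ ℝ) {D : ℕ} (hG : ∀ i, (G i).totalDegree ≤ D) :
    (bind₁ G F).totalDegree ≤ F.totalDegree * D := by
  conv_lhs => rw [F.as_sum, map_sum]
  refine totalDegree_finsetSum_le fun s hs => ?_
  rw [bind₁_monomial]
  refine (totalDegree_mul _ _).trans ?_
  rw [totalDegree_C, zero_add]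
  refine (totalDegree_finsetProd _ _).trans ?_
  refine le_trans (Finset.sum_le_sum fun i _ => (totalDegree_pow _ _).trans
    (Nat.mul_le_mul_left _ (hG i))) ?_
  rw [← Finset.sum_mul]
  exact Nat.mul_le_mul_right _ (le_totalDegree hs)

open MvPolynomial in
/-- `n + 1` polynomials of bounded degree in `n` variables satisfy a nontrivial polynomial relation
of bounded degree. -/
theorem MvPolynomial.exists_bind₁_eq_zero (n D : ℕ) : ∃ m : ℕ,
    ∀ G : Fin (n + 1) → MvPolynomial (Fin n) ℝ, (∀ i, (G i).totalDegree ≤ D) →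
      ∃ P : MvPolynomial (Fin (n + 1)) ℝ, P ≠ 0 ∧ (∀ i, P.degreeOf i ≤ m) ∧ bind₁ G P = 0 := by
  classical
  set m := (D * (n + 1) + 1) ^ n with hm
  refine ⟨m, fun G hG => ?_⟩
  set N := (n + 1) * m * D with hN
  let e : (Fin (n + 1) → Fin (m + 1)) → Fin (n + 1) →₀ ℕ :=
    fun k => Finsupp.equivFunOnFinite.symm fun i => (k i : ℕ)
  have he : Function.Injective e := by
    intro k k' h
    funext i
    have := DFunLike.congr_fun h i
    exact Fin.ext (by simpa [e] using this)
  let mk : ((Fin (n + 1) → Fin (m + 1)) → ℝ) →ₗ[ℝ] MvPolynomial (Fin (n + 1)) ℝ :=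
    ∑ k, (monomial (e k)).comp (LinearMap.proj k)
  let co : MvPolynomial (Fin n) ℝ →ₗ[ℝ] ((Fin n → Fin (N + 1)) → ℝ) :=
    LinearMap.pi fun k => lcoeff ℝ (Finsupp.equivFunOnFinite.symm fun i => (k i : ℕ))
  have hmk (c) : mk c = ∑ k, monomial (e k) (c k) := by simp [mk]
  have hker : LinearMap.ker (co ∘ₗ (bind₁ G).toLinearMap ∘ₗ mk) ≠ ⊥ := by
    apply LinearMap.ker_ne_bot_of_finrank_lt
    simp only [Module.finrank_fintype_fun_eq_card, Fintype.card_pi, Fintype.card_fin,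
      Finset.prod_const, Finset.card_univ]
    have h1 : N + 1 ≤ (D * (n + 1) + 1) * (m + 1) := by rw [hN]; nlinarith
    calc (N + 1) ^ n ≤ ((D * (n + 1) + 1) * (m + 1)) ^ n := Nat.pow_le_pow_left h1 n
      _ = m * (m + 1) ^ n := by rw [mul_pow]
      _ < (m + 1) ^ (n + 1) := by
        rw [pow_succ']
        exact Nat.mul_lt_mul_of_pos_right (Nat.lt_succ_self m) (by positivity)
  obtain ⟨c, hc, hc0⟩ := Submodule.exists_mem_ne_zero_of_ne_bot hker
  have hdeg : ∀ i, (mk c).degreeOf i ≤ m := by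
    intro i
    rw [hmk]
    refine (degreeOf_sum_le i _ _).trans (Finset.sup_le fun k _ => ?_)
    by_cases h : c k = 0
    · simp [h]
    · rw [degreeOf_monomial_eq _ _ h]
      simp [e]; omega
  refine ⟨mk c, ?_, hdeg, ?_⟩
  · intro h
    apply hc0
    funext k
    have := congrArg (coeff (e k)) h
    rw [hmk, coeff_sum] at this
    simpa [coeff_monomial, he.eq_iff] using this
  · have htd : (bind₁ G (mk c)).totalDegree ≤ N := by
      refine (totalDegree_bind₁_le G _ hG).trans (Nat.mul_le_mul_right _ ?_)
      rw [hmk]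
      refine totalDegree_finsetSum_le fun k _ => (totalDegree_monomial_le _ _).trans ?_
      rw [Finsupp.sum_fintype _ _ (fun _ => rfl)]
      refine (Finset.sum_le_card_nsmul _ _ m fun i _ => ?_).trans (by simp)
      simp [e]; omega
    ext s
    rw [coeff_zero]
    by_cases hs : s ∈ (bind₁ G (mk c)).support
    · have hle : ∀ i, s i < N + 1 := fun i =>
        Nat.lt_succ_of_le (((Finsupp.le_degree i s)).trans ((le_totalDegree hs).trans htd))
      have := congrFun (show co (bind₁ G (mk c)) = 0 from hc) (fun i => ⟨s i, hle i⟩)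
      simpa [co] using this
    · simpa using hs

open MvPolynomial in
/-- The generic fibres of a polynomial map `ℝⁿ → ℝⁿ` of bounded degree are finite of bounded
cardinality. -/
theorem MvPolynomial.exists_fibre_card_le (n D : ℕ) : ∃ m : ℕ,
    ∀ g : Fin n → MvPolynomial (Fin n) ℝ, (∀ i, (g i).totalDegree ≤ D) →
      ∃ Q : MvPolynomial (Fin n) ℝ, Q ≠ 0 ∧ ∀ a : Fin n → ℝ, eval a Q ≠ 0 →
        ∃ t : Finset (Fin n → ℝ), t.card ≤ m ∧ ∀ x, (∀ i, eval x (g i) = a i) → x ∈ t := by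
  classical
  obtain ⟨m, hm⟩ := exists_bind₁_eq_zero n (D + 1)
  refine ⟨m ^ n, fun g hg => ?_⟩
  have key : ∀ j : Fin n, ∃ P : MvPolynomial (Fin (n + 1)) ℝ, P ≠ 0 ∧ (∀ i, P.degreeOf i ≤ m) ∧
      bind₁ (Fin.cons (X j) g : Fin (n + 1) → MvPolynomial (Fin n) ℝ) P = 0 := fun j => by
    refine hm _ fun i => ?_
    refine Fin.cases ?_ (fun i => ?_) i
    · simp
    · simpa using (hg i).trans (Nat.le_succ _)
  choose P hP0 hPd hPz using key
  let Q := ∏ j, (finSuccEquiv ℝ n (P j)).leadingCoeff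
  refine ⟨Q, ?_, fun a ha => ?_⟩
  · refine Finset.prod_ne_zero_iff.2 fun j _ => ?_
    rw [Ne, Polynomial.leadingCoeff_eq_zero]
    simpa using hP0 j
  let R : Fin n → Polynomial ℝ := fun j => (finSuccEquiv ℝ n (P j)).map (eval a)
  have hR0 : ∀ j, R j ≠ 0 := by
    intro j h
    have h1 := congrArg (fun p => Polynomial.coeff p (finSuccEquiv ℝ n (P j)).natDegree) h
    simp only [R, Polynomial.coeff_map, Polynomial.coeff_zero] at h1
    apply ha
    simp only [Q, map_prod]
    exact Finset.prod_eq_zero (Finset.mem_univ j) h1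
  refine ⟨Fintype.piFinset fun j => (R j).roots.toFinset, ?_, fun x hx => ?_⟩
  · rw [Fintype.card_piFinset]
    refine (Finset.prod_le_pow_card _ _ m fun j _ => ?_).trans (by simp)
    refine (Multiset.toFinset_card_le _).trans ((Polynomial.card_roots' _).trans ?_)
    refine Polynomial.natDegree_map_le.trans ?_
    rw [natDegree_finSuccEquiv]
    exact hPd j 0
  · rw [Fintype.mem_piFinset]
    intro j
    rw [Multiset.mem_toFinset, Polynomial.mem_roots (hR0 j), Polynomial.IsRoot]
    have h1 := congrArg (eval x) (hPz j)
    rw [map_zero] at h1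
    have h2 : eval x (bind₁ (Fin.cons (X j) g : Fin (n + 1) → MvPolynomial (Fin n) ℝ) (P j))
        = eval (Fin.cons (x j) a : Fin (n + 1) → ℝ) (P j) := by
      rw [← coe_aeval_eq_eval, RingHom.coe_coe, aeval_bind₁, ← coe_aeval_eq_eval, RingHom.coe_coe]
      congr 2
      funext i
      refine Fin.cases ?_ (fun i => ?_) i
      · simp
      · simpa [aeval_eq_eval] using hx i
    rw [h2, eval_eq_eval_mv_eval'] at h1
    exact h1

open MvPolynomial in
theorem MvPolynomial.exists_norm_lt_eval_ne_zero {n : ℕ} {Q : MvPolynomial (Fin n) ℝ} (hQ : Q ≠ 0)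
    {δ : ℝ} (hδ : 0 < δ) : ∃ a : Fin n → ℝ, ‖a‖ < δ ∧ eval a Q ≠ 0 := by
  by_contra! h
  apply hQ
  refine MvPolynomial.funext_set (s := fun _ => Ioo (-δ) δ) (fun _ => ?_) fun x hx => ?_
  · exact Ioo_infinite (by linarith)
  · rw [map_zero]
    refine h x ((pi_norm_lt_iff hδ).2 fun i => ?_)
    exact abs_lt.2 (hx i (mem_univ i))

theorem Finset.exists_pos_forall_of_antitone {α : Type*} (s : Finset α) (P : α → ℝ → Prop)
    (hmono : ∀ a r r', r' ≤ r → P a r → P a r') (h : ∀ a ∈ s, ∃ r > 0, P a r) :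
    ∃ r > 0, ∀ a ∈ s, P a r := by
  classical
  induction s using Finset.induction_on with
  | empty => exact ⟨1, one_pos, by simp⟩
  | insert b s hb ih =>
    obtain ⟨r, hr, h1⟩ := ih fun a ha => h a (Finset.mem_insert_of_mem ha)
    obtain ⟨r', hr', h2⟩ := h b (Finset.mem_insert_self _ _)
    refine ⟨min r r', lt_min hr hr', fun a ha => ?_⟩
    rcases Finset.mem_insert.1 ha with rfl | ha
    · exact hmono _ _ _ (min_le_right _ _) h2
    · exact hmono _ _ _ (min_le_left _ _) (h1 a ha)

namespace MvPolynomial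

theorem continuous_eval' {n : ℕ} (F : MvPolynomial (Fin n) ℝ) :
    Continuous fun x : Fin n → ℝ => eval x F :=
  continuous_iff_continuousAt.2 fun x => (hasFDerivAt_eval F x).continuousAt

theorem eval_pderiv_eq_zero_of_isLocalMin {n : ℕ} {F : MvPolynomial (Fin n) ℝ} {x : Fin n → ℝ}
    (h : IsLocalMin (fun y => eval y F) x) (i : Fin n) : eval x (pderiv i F) = 0 := by
  classical
  have := congrArg (fun l => l (Pi.single i 1)) (h.hasFDerivAt_eq_zero (hasFDerivAt_eval F x))
  simpa [Pi.single_apply] using this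

/-- If a polynomial is smaller at a point of a bounded open set than on its frontier, then its
gradient takes every sufficiently small value on that set. -/
theorem exists_forall_pderiv_eq {n : ℕ} (F : MvPolynomial (Fin n) ℝ) {U : Set (Fin n → ℝ)}
    (hU : IsOpen U) (hUb : Bornology.IsBounded U) {y : Fin n → ℝ} (hy : y ∈ U) {b : ℝ}
    (hyb : eval y F < b) (hfr : ∀ x ∈ frontier U, b ≤ eval x F) :
    ∃ δ > 0, ∀ a : Fin n → ℝ, ‖a‖ < δ → ∃ z ∈ U, ∀ i, eval z (pderiv i F) = a i := by
  obtain ⟨B, hB0, hB⟩ := hUb.closure.exists_pos_norm_le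
  have hpos : 0 < 2 * (n * B) + 1 := by positivity
  refine ⟨(b - eval y F) / (2 * (n * B) + 1), div_pos (by linarith) hpos, fun a ha => ?_⟩
  rw [lt_div_iff₀ hpos] at ha
  let Ψ := F - ∑ i, C (a i) * X i
  have hΨ : ∀ x, eval x Ψ = eval x F - ∑ i, a i * x i := fun x => by simp [Ψ]
  have hsum : ∀ x ∈ closure U, |∑ i, a i * x i| ≤ n * B * ‖a‖ := by
    intro x hx
    refine (Finset.abs_sum_le_sum_abs _ _).trans ?_
    refine (Finset.sum_le_card_nsmul _ _ (B * ‖a‖) fun i _ => ?_).trans (by simp [mul_assoc])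
    rw [abs_mul, mul_comm]
    exact mul_le_mul ((norm_le_pi_norm x i).trans (hB x hx)) (norm_le_pi_norm a i)
      (abs_nonneg _) hB0.le
  obtain ⟨z, hz, hmin⟩ := (hUb.isCompact_closure).exists_isMinOn ⟨y, subset_closure hy⟩
    (continuous_eval' Ψ).continuousOn
  have hzU : z ∈ U := by
    by_contra hzU
    have h1 : z ∈ frontier U := by rw [hU.frontier_eq]; exact ⟨hz, hzU⟩
    have h2 : eval z Ψ ≤ eval y Ψ := hmin (subset_closure hy)
    rw [hΨ, hΨ] at h2
    have h3 := abs_le.1 (hsum z hz)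
    have h4 := abs_le.1 (hsum y (subset_closure hy))
    have h5 := hfr z h1
    have h6 := norm_nonneg a
    nlinarith
  refine ⟨z, hzU, fun i => ?_⟩
  have hloc : IsLocalMin (fun x => eval x Ψ) z :=
    (hmin.on_subset subset_closure).isLocalMin (hU.mem_nhds hzU)
  have := eval_pderiv_eq_zero_of_isLocalMin hloc i
  simp only [Ψ, map_sub, map_sum, Derivation.leibniz, pderiv_X, pderiv_C, smul_eq_mul] at this
  simp [Pi.single_apply, apply_ite] at this
  linarith

/-- A polynomial of bounded degree has boundedly many disjoint wells. -/
theorem exists_card_wells_le (n D : ℕ) : ∃ m : ℕ, ∀ F : MvPolynomial (Fin n) ℝ,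
    F.totalDegree ≤ D → ∀ (s : Finset (Fin n → ℝ)) (U : (Fin n → ℝ) → Set (Fin n → ℝ)),
      (∀ y ∈ s, IsOpen (U y) ∧ Bornology.IsBounded (U y) ∧ y ∈ U y ∧ eval y F < 1 ∧
        ∀ x ∈ frontier (U y), 1 ≤ eval x F) →
      (∀ y ∈ s, ∀ z ∈ s, y ≠ z → Disjoint (U y) (U z)) → s.card ≤ m := by
  obtain ⟨m, hm⟩ := exists_fibre_card_le n D
  refine ⟨m, fun F hF s U hU hdisj => ?_⟩
  obtain ⟨Q, hQ, hfib⟩ := hm (fun i => pderiv i F) fun i => (totalDegree_pderiv_le F i).trans hF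
  obtain ⟨δ, hδ, hδs⟩ := s.exists_pos_forall_of_antitone
    (fun y δ => ∀ a : Fin n → ℝ, ‖a‖ < δ → ∃ z ∈ U y, ∀ i, eval z (pderiv i F) = a i)
    (fun y r r' hr h a ha => h a (ha.trans_le hr))
    (fun y hy => by
      obtain ⟨h1, h2, h3, h4, h5⟩ := hU y hy
      exact exists_forall_pderiv_eq F h1 h2 h3 h4 h5)
  obtain ⟨a, ha, haQ⟩ := exists_norm_lt_eval_ne_zero hQ hδ
  obtain ⟨t, ht, htm⟩ := hfib a haQ
  have hz : ∀ y, ∃ z, y ∈ s → z ∈ U y ∧ ∀ i, eval z (pderiv i F) = a i := fun y => by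
    by_cases hy : y ∈ s
    · obtain ⟨z, hz⟩ := hδs y hy a ha
      exact ⟨z, fun _ => hz⟩
    · exact ⟨y, fun h => absurd h hy⟩
  choose z hz using hz
  refine (Finset.card_le_card_of_injOn z (fun y hy => htm _ (hz y hy).2) ?_).trans ht
  intro y hy y' hy' h
  by_contra hne
  exact disjoint_left.1 (hdisj y hy y' hy' hne) (hz y hy).1 (h ▸ (hz y' hy').1)

end MvPolynomial

theorem IsCompact.exists_isClosed_separating {α : Type*} [TopologicalSpace α] [T2Space α]
    {Z : Set α} (hZ : IsCompact Z) {x y : α} (hx : x ∈ Z) (hy : y ∈ Z)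
    (h : ¬ ∃ ζ ⊆ Z, IsPreconnected ζ ∧ x ∈ ζ ∧ y ∈ ζ) :
    ∃ V ⊆ Z, IsClosed V ∧ IsClosed (Z \ V) ∧ x ∈ V ∧ y ∉ V := by
  have := isCompact_iff_compactSpace.1 hZ
  by_contra! hV
  apply h
  refine ⟨Subtype.val '' connectedComponent (⟨x, hx⟩ : Z), by rintro _ ⟨z, _, rfl⟩; exact z.2,
    isPreconnected_connectedComponent.image _ continuous_subtype_val.continuousOn,
    ⟨_, mem_connectedComponent, rfl⟩, ⟨⟨y, hy⟩, ?_, rfl⟩⟩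
  rw [connectedComponent_eq_iInter_isClopen, mem_iInter]
  rintro ⟨W, hW, hxW⟩
  have hemb := hZ.isClosed.isClosedEmbedding_subtypeVal
  have h1 := hV (Subtype.val '' W) (by rintro _ ⟨z, _, rfl⟩; exact z.2)
    (hemb.isClosedMap _ hW.1) (by
      have : Z \ (Subtype.val '' W) = Subtype.val '' Wᶜ := by
        ext z
        constructor
        · rintro ⟨hz, hzW⟩
          exact ⟨⟨z, hz⟩, fun h => hzW ⟨_, h, rfl⟩, rfl⟩
        · rintro ⟨z, hz, rfl⟩
          refine ⟨z.2, ?_⟩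
          rintro ⟨w, hw, hwz⟩
          exact hz (Subtype.ext hwz ▸ hw)
      rw [this]
      exact hemb.isClosedMap _ hW.2.isClosed_compl) ⟨_, hxW, rfl⟩
  obtain ⟨w, hw, hwy⟩ := h1
  exact (Subtype.ext hwy : w = ⟨y, hy⟩) ▸ hw

/-- Points of a compact set in pairwise different components have disjoint open neighbourhoods
whose frontiers avoid the compact set. -/
theorem IsCompact.exists_disjoint_open_frontier {α : Type*} [PseudoMetricSpace α] [T2Space α]
    {Z : Set α} (hZ : IsCompact Z) (s : Finset α) (hs : ∀ y ∈ s, y ∈ Z)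
    (h : ∀ y ∈ s, ∀ z ∈ s, y ≠ z → ¬ ∃ ζ ⊆ Z, IsPreconnected ζ ∧ y ∈ ζ ∧ z ∈ ζ) :
    ∃ U : α → Set α, (∀ y ∈ s, IsOpen (U y) ∧ Bornology.IsBounded (U y) ∧ y ∈ U y ∧
        Disjoint (frontier (U y)) Z) ∧
      ∀ y ∈ s, ∀ z ∈ s, y ≠ z → Disjoint (U y) (U z) := by
  have hV : ∀ y z, ∃ V : Set α, y ∈ s → z ∈ s → y ≠ z →
      V ⊆ Z ∧ IsClosed V ∧ IsClosed (Z \ V) ∧ y ∈ V ∧ z ∉ V := fun y z => by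
    by_cases hyz : y ∈ s ∧ z ∈ s ∧ y ≠ z
    · obtain ⟨V, hV⟩ := hZ.exists_isClosed_separating (hs y hyz.1) (hs z hyz.2.1)
        (h y hyz.1 z hyz.2.1 hyz.2.2)
      exact ⟨V, fun _ _ _ => hV⟩
    · exact ⟨∅, fun h1 h2 h3 => absurd ⟨h1, h2, h3⟩ hyz⟩
  choose V hV using hV
  let W : α → Set α := fun y => {x ∈ Z | ∀ u ∈ s, u ≠ y → x ∈ V y u ∧ x ∉ V u y}
  have hWZ : ∀ y, W y ⊆ Z := fun y x hx => hx.1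
  have hyW : ∀ y ∈ s, y ∈ W y := fun y hy => ⟨hs y hy, fun u hu huy =>
    ⟨(hV y u hy hu huy.symm).2.2.2.1, (hV u y hu hy huy).2.2.2.2⟩⟩
  have hWc : ∀ y ∈ s, IsClosed (W y) := by
    intro y hy
    have : W y = Z ∩ ⋂ u ∈ s, ⋂ (_ : u ≠ y), (V y u ∩ (Z \ V u y)) := by
      ext x
      simp only [W, mem_ofPred_eq, mem_inter_iff, mem_iInter, mem_sdiff]
      constructor
      · rintro ⟨h1, h2⟩
        exact ⟨h1, fun u hu huy => ⟨(h2 u hu huy).1, h1, (h2 u hu huy).2⟩⟩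
      · rintro ⟨h1, h2⟩
        exact ⟨h1, fun u hu huy => ⟨(h2 u hu huy).1, (h2 u hu huy).2.2⟩⟩
    rw [this]
    refine hZ.isClosed.inter (isClosed_iInter fun u => isClosed_iInter fun hu =>
      isClosed_iInter fun huy => ?_)
    exact (hV y u hy hu huy.symm).2.1.inter (hV u y hu hy huy).2.2.1
  have hWc' : ∀ y ∈ s, IsClosed (Z \ W y) := by
    intro y hy
    have : Z \ W y = ⋃ u ∈ {u | u ∈ s ∧ u ≠ y}, ((Z \ V y u) ∪ V u y) := by
      ext x
      simp only [W, mem_ofPred_eq, mem_iUnion, mem_sdiff, mem_union, exists_prop]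
      constructor
      · rintro ⟨h1, h2⟩
        by_contra! h3
        refine h2 ⟨h1, fun u hu huy => ?_⟩
        exact ⟨by_contra fun h4 => h4 ((h3 u ⟨hu, huy⟩).1 h1), (h3 u ⟨hu, huy⟩).2⟩
      · rintro ⟨u, ⟨hu, huy⟩, h1 | h1⟩
        · exact ⟨h1.1, fun h2 => h1.2 (h2.2 u hu huy).1⟩
        · exact ⟨(hV u y hu hy huy).1 h1, fun h2 => (h2.2 u hu huy).2 h1⟩
    rw [this]
    refine Set.Finite.isClosed_biUnion (s.finite_toSet.subset fun u hu => hu.1) ?_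
    rintro u ⟨hu, huy⟩
    exact (hV y u hy hu huy.symm).2.2.1.union (hV u y hu hy huy).2.1
  obtain ⟨r, hr, hrs⟩ := s.exists_pos_forall_of_antitone
    (fun y r => Disjoint (thickening r (W y)) (thickening r (Z \ W y)))
    (fun y r r' hr h => h.mono (thickening_mono hr _) (thickening_mono hr _))
    (fun y hy => disjoint_sdiff_right.exists_thickenings
      (hZ.of_isClosed_subset (hWc y hy) (hWZ y)) (hWc' y hy))
  refine ⟨fun y => thickening r (W y), fun y hy => ⟨isOpen_thickening,
    (hZ.isBounded.subset (hWZ y)).thickening, self_subset_thickening hr _ (hyW y hy), ?_⟩, ?_⟩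
  · rw [disjoint_left]
    intro x hx hxZ
    rw [isOpen_thickening.frontier_eq] at hx
    have hxW : x ∉ W y := fun h => hx.2 (self_subset_thickening hr _ h)
    exact disjoint_left.1 ((hrs y hy).closure_left isOpen_thickening) hx.1
      (self_subset_thickening hr _ ⟨hxZ, hxW⟩)
  · intro y hy z hz hyz
    have hsub : W z ⊆ Z \ W y := fun x hx =>
      ⟨hx.1, fun hx' => (hx'.2 z hz hyz.symm).2 (hx.2 y hy hyz).1⟩
    exact (hrs y hy).mono_right (thickening_subset_of_subset r hsub)

namespace MvPolynomial

/-- The number of connected components of a bounded real algebraic set is bounded in terms of the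
number of variables and the degree. -/
theorem exists_card_components_le (n D : ℕ) : ∃ m : ℕ, ∀ F g : MvPolynomial (Fin n) ℝ,
    F.totalDegree ≤ D → g.totalDegree ≤ D →
    {x : Fin n → ℝ | eval x F ≤ 1} ⊆ closedBall 0 1 → (∀ x, 0 ≤ eval x g) →
    ∀ s : Finset (Fin n → ℝ), (∀ y ∈ s, eval y F < 1 ∧ eval y g = 0) →
      (∀ y ∈ s, ∀ z ∈ s, y ≠ z →
        ¬ ∃ ζ ⊆ {x : Fin n → ℝ | eval x F ≤ 1 ∧ eval x g = 0}, IsPreconnected ζ ∧ y ∈ ζ ∧ z ∈ ζ) →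
      s.card ≤ m := by
  obtain ⟨m, hm⟩ := exists_card_wells_le n D
  refine ⟨m, fun F g hF hg hb hg0 s hs hsep => ?_⟩
  have hFc := continuous_eval' F
  have hgc := continuous_eval' g
  have hFcl : IsClosed {x : Fin n → ℝ | eval x F ≤ 1} := isClosed_le hFc continuous_const
  have hZ : IsCompact {x : Fin n → ℝ | eval x F ≤ 1 ∧ eval x g = 0} :=
    (isCompact_closedBall (0 : Fin n → ℝ) 1).of_isClosed_subset
      (hFcl.inter (isClosed_eq hgc continuous_const)) fun x hx => hb hx.1
  obtain ⟨U, hU, hdisj⟩ := hZ.exists_disjoint_open_frontier s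
    (fun y hy => ⟨(hs y hy).1.le, (hs y hy).2⟩) hsep
  let T : Set (Fin n → ℝ) := (⋃ y ∈ s, frontier (U y)) ∩ {x | eval x F ≤ 1}
  have hT : IsCompact T := (isCompact_closedBall (0 : Fin n → ℝ) 1).of_isClosed_subset
    (IsClosed.inter (s.finite_toSet.isClosed_biUnion fun y _ => isClosed_frontier) hFcl)
    fun x hx => hb hx.2
  have hgT : ∀ x ∈ T, 0 < eval x g := by
    rintro x ⟨hx, hxF⟩
    simp only [mem_iUnion] at hx
    obtain ⟨y, hy, hx⟩ := hx
    exact lt_of_le_of_ne (hg0 x) fun h =>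
      disjoint_left.1 (hU y hy).2.2.2 hx ⟨hxF, h.symm⟩
  obtain ⟨K, hK⟩ := hT.bddAbove_image (f := fun x => (1 - eval x F) / eval x g)
    ((continuous_const.sub hFc).continuousOn.div hgc.continuousOn fun x hx => (hgT x hx).ne')
  have heval : ∀ x, eval x (F + C (max K 0) * g) = eval x F + max K 0 * eval x g := by simp
  refine hm (F + C (max K 0) * g) ?_ s U (fun y hy => ?_) hdisj
  · refine (totalDegree_add _ _).trans (max_le hF ((totalDegree_mul _ _).trans ?_))
    simpa using hg
  · refine ⟨(hU y hy).1, (hU y hy).2.1, (hU y hy).2.2.1, ?_, fun x hx => ?_⟩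
    · rw [heval, (hs y hy).2]; simpa using (hs y hy).1
    · rw [heval]
      by_cases hxF : eval x F ≤ 1
      · have hxT : x ∈ T := ⟨by simp only [mem_iUnion]; exact ⟨y, hy, hx⟩, hxF⟩
        have h1 := hK (mem_image_of_mem _ hxT)
        rw [div_le_iff₀ (hgT x hxT)] at h1
        have h2 := mul_le_mul_of_nonneg_right (le_max_left K 0) (hgT x hxT).le
        linarith
      · have := mul_nonneg (le_max_right K 0) (hg0 x)
        linarith [not_le.1 hxF]

end MvPolynomial

theorem IsPreconnected.dist_le_of_image_subset {α : Type*} [TopologicalSpace α] {Y : Set α}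
    (hY : IsPreconnected Y) {p : α → ℝ} (hp : ContinuousOn p Y) (G : Finset ℝ) {r : ℝ}
    (hr : 0 ≤ r) (hG : p '' Y ⊆ ⋃ c ∈ G, closedBall c r) {x y : α} (hx : x ∈ Y) (hy : y ∈ Y) :
    |p x - p y| ≤ G.card * (2 * r) := by
  wlog h : p y ≤ p x generalizing x y
  · rw [abs_sub_comm]
    exact this hy hx (le_of_not_ge h)
  rw [abs_of_nonneg (sub_nonneg.2 h)]
  have h1 : Icc (p y) (p x) ⊆ ⋃ c ∈ G, closedBall c r :=
    ((hY.image p hp).Icc_subset ⟨y, hy, rfl⟩ ⟨x, hx, rfl⟩).trans hG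
  have h2 := (MeasureTheory.measure_mono (μ := MeasureTheory.volume) h1).trans
    (MeasureTheory.measure_biUnion_finset_le G _)
  simp only [Real.volume_Icc, Real.volume_closedBall, Finset.sum_const, nsmul_eq_mul] at h2
  rw [← ENNReal.ofReal_natCast, ← ENNReal.ofReal_mul (Nat.cast_nonneg _)] at h2
  exact (ENNReal.ofReal_le_ofReal_iff (by positivity)).1 h2

theorem continuousOn_of_local_lipschitz {E : Type*} [SeminormedAddCommGroup E] {Y : Set E}
    {p : E → ℝ} {δ : ℝ} (hδ : 0 < δ)
    (hp : ∀ x ∈ Y, ∀ y ∈ Y, ‖x - y‖ ≤ δ → |p x - p y| ≤ ‖x - y‖) : ContinuousOn p Y := by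
  rw [Metric.continuousOn_iff]
  intro x hx ε hε
  refine ⟨min δ ε, lt_min hδ hε, fun y hy hxy => ?_⟩
  rw [dist_eq_norm] at hxy
  rw [Real.dist_eq]
  exact (hp y hy x hx (hxy.le.trans (min_le_left _ _))).trans_lt (hxy.trans_le (min_le_right _ _))

/-- A connected set which generically meets every coordinate hyperplane in at most `m` points has
bounded intrinsic diameter. -/
theorem IsPreconnected.dist_le_of_hyperplane_sections {d m : ℕ} {ζ : Set (Fin d → ℝ)}
    (hζ : IsPreconnected ζ) (hb : ζ ⊆ closedBall 0 1) (B : Fin d → Finset ℝ)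
    (hB : ∀ i, ∀ c ∉ B i, ∃ t : Finset (Fin d → ℝ), t.card ≤ m ∧ ∀ x ∈ ζ, x i = c → x ∈ t)
    {p : (Fin d → ℝ) → ℝ} {δ : ℝ} (hδ : 0 < δ)
    (hp : ∀ x ∈ ζ, ∀ y ∈ ζ, ‖x - y‖ ≤ δ → |p x - p y| ≤ ‖x - y‖) :
    ∀ x ∈ ζ, ∀ y ∈ ζ, |p x - p y| ≤ 8 * d * m + 2 := by
  classical
  obtain ⟨K', hK'⟩ := exists_nat_one_div_lt hδ
  set K : ℕ := K' + 1 with hKdef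
  have hK : (1 : ℝ) ≤ K := by simp [hKdef]
  have hK0 : (0 : ℝ) < K := by linarith
  have hKδ : 1 / (K : ℝ) ≤ δ := by simpa [hKdef] using hK'.le
  let I : Finset ℤ := Finset.Icc (-(K : ℤ) - 1) K
  let bad : Finset ℝ := Finset.univ.biUnion fun i => (B i ×ˢ I).image fun q => K * q.1 - q.2
  obtain ⟨τ, ⟨hτ0, hτ1⟩, hτ⟩ := (Ioo_infinite (zero_lt_one' ℝ)).exists_notMem_finset bad
  have hgood : ∀ i, ∀ k ∈ I, (k + τ) / K ∉ B i := by
    intro i k hk h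
    apply hτ
    simp only [bad, Finset.mem_biUnion, Finset.mem_image, Finset.mem_product]
    refine ⟨i, Finset.mem_univ _, ((k + τ) / K, k), ⟨h, hk⟩, ?_⟩
    field_simp
    ring
  have ht : ∀ i, ∀ k : ℤ, ∃ t : Finset (Fin d → ℝ), t.card ≤ m ∧
      (k ∈ I → ∀ x ∈ ζ, x i = (k + τ) / K → x ∈ t) := fun i k => by
    by_cases hk : k ∈ I
    · obtain ⟨t, h1, h2⟩ := hB i _ (hgood i k hk)
      exact ⟨t, h1, fun _ => h2⟩
    · exact ⟨∅, by simp, fun h => absurd h hk⟩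
  choose t htm ht using ht
  let G : Finset (Fin d → ℝ) := Finset.univ.biUnion fun i => I.biUnion fun k => t i k
  have hGmem : ∀ x ∈ ζ, ∀ i, ∀ k ∈ I, x i = (k + τ) / K → x ∈ G := fun x hx i k hk h => by
    simp only [G, Finset.mem_biUnion]
    exact ⟨i, Finset.mem_univ _, k, hk, ht i k hk x hx h⟩
  have hGcard : (G.card : ℝ) ≤ d * ((2 * K + 2) * m) := by
    have hI : I.card = 2 * K + 2 := by simp only [I, Int.card_Icc]; omega
    have : G.card ≤ d * ((2 * K + 2) * m) := by
      refine (Finset.card_biUnion_le_card_mul _ _ ((2 * K + 2) * m) fun i _ => ?_).trans (by simp)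
      rw [← hI]
      exact Finset.card_biUnion_le_card_mul _ _ _ fun k _ => htm i k
    exact_mod_cast this
  have hnear : ∀ x ∈ ζ, (∀ y ∈ ζ, |p x - p y| ≤ 1 / K) ∨ ∃ g ∈ G, |p x - p g| ≤ 1 / K := by
    intro x hx
    let k : Fin d → ℤ := fun i => ⌊K * x i - τ⌋
    have hk1 : ∀ i, (k i + τ) / K ≤ x i := fun i => by
      rw [div_le_iff₀ hK0]; linarith [Int.floor_le (K * x i - τ)]
    have hk2 : ∀ i, x i < (k i + 1 + τ) / K := fun i => by
      rw [lt_div_iff₀ hK0]; linarith [Int.lt_floor_add_one (K * x i - τ)]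
    have hxb : ∀ i, |x i| ≤ 1 := fun i =>
      (norm_le_pi_norm x i).trans (mem_closedBall_zero_iff.1 (hb hx))
    have hkI : ∀ i, -(K : ℤ) - 1 ≤ k i ∧ k i + 1 ≤ K := by
      intro i
      have hxi := abs_le.1 (hxb i)
      constructor
      · refine Int.le_floor.2 ?_
        push_cast
        nlinarith
      · have h1 : k i < K := Int.floor_lt.2 (by push_cast; nlinarith)
        omega
    have hkm : ∀ i, k i ∈ I := fun i => Finset.mem_Icc.2 ⟨(hkI i).1, by have := (hkI i).2; omega⟩
    have hkm' : ∀ i, k i + 1 ∈ I := fun i =>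
      Finset.mem_Icc.2 ⟨by have := (hkI i).1; omega, (hkI i).2⟩
    let Q : Set (Fin d → ℝ) := Icc (fun i => (k i + τ) / K) (fun i => (k i + 1 + τ) / K)
    let O : Set (Fin d → ℝ) := pi univ fun i => Ioo ((k i + τ) / K) ((k i + 1 + τ) / K)
    have hO : IsOpen O := isOpen_set_pi finite_univ fun i _ => isOpen_Ioo
    have hOQ : closure O ⊆ Q := closure_minimal
      (fun y hy => ⟨fun i => (hy i (mem_univ i)).1.le, fun i => (hy i (mem_univ i)).2.le⟩)
      isClosed_Icc
    have hQ : ∀ y ∈ Q, ‖x - y‖ ≤ 1 / K := by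
      intro y hy
      refine (pi_norm_le_iff_of_nonneg (by positivity)).2 fun i => ?_
      have h1 := hy.1 i
      have h2 := hy.2 i
      have h3 := hk1 i
      have h4 := hk2 i
      have h5 : ((k i + 1 + τ) / K : ℝ) = (k i + τ) / K + 1 / K := by ring
      simp only [Pi.sub_apply, Real.norm_eq_abs, abs_le]
      constructor <;> linarith
    have hpQ : ∀ y ∈ ζ, y ∈ Q → |p x - p y| ≤ 1 / K := fun y hy hyQ =>
      (hp x hx y hy ((hQ y hyQ).trans hKδ)).trans (hQ y hyQ)
    by_cases hxO : x ∈ O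
    · by_cases hfr : ∃ g ∈ ζ, g ∈ closure O ∧ g ∉ O
      · obtain ⟨g, hg, hgO, hgO'⟩ := hfr
        refine Or.inr ⟨g, ?_, hpQ g hg (hOQ hgO)⟩
        have hgQ := hOQ hgO
        simp only [O, mem_pi, mem_univ, true_imp_iff, not_forall] at hgO'
        obtain ⟨i, hi⟩ := hgO'
        by_cases h1 : g i = (k i + τ) / K
        · exact hGmem g hg i _ (hkm i) h1
        · refine hGmem g hg i _ (hkm' i) ?_
          have h2 : (k i + τ) / K < g i := lt_of_le_of_ne (hgQ.1 i) (Ne.symm h1)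
          push_cast
          exact le_antisymm (hgQ.2 i) (not_lt.1 fun h3 => hi ⟨h2, h3⟩)
      · push Not at hfr
        have hsub : ζ ⊆ O := hζ.subset_left_of_subset_union hO isClosed_closure.isOpen_compl
          (disjoint_compl_right.mono_left subset_closure)
          (fun y hy => or_iff_not_imp_right.2 fun h => hfr y hy (not_not.1 h)) ⟨x, hx, hxO⟩
        exact Or.inl fun y hy => hpQ y hy (hOQ (subset_closure (hsub hy)))
    · simp only [O, mem_pi, mem_univ, true_imp_iff, not_forall] at hxO
      obtain ⟨i, hi⟩ := hxO
      refine Or.inr ⟨x, hGmem x hx i _ (hkm i) ?_, by simp⟩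
      exact le_antisymm (not_lt.1 fun h => hi ⟨h, hk2 i⟩) (hk1 i)
  intro x hx y hy
  have hnn : (0 : ℝ) ≤ 8 * d * m := by positivity
  have hK1 : 1 / (K : ℝ) ≤ 1 := by rw [div_le_one hK0]; exact hK
  by_cases hall : ∀ x ∈ ζ, ∃ g ∈ G, |p x - p g| ≤ 1 / K
  · have hcov : p '' ζ ⊆ ⋃ c ∈ G.image p, closedBall c (1 / (K : ℝ)) := by
      rintro _ ⟨z, hz, rfl⟩
      obtain ⟨g, hg, hzg⟩ := hall z hz
      simp only [mem_iUnion]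
      exact ⟨p g, Finset.mem_image_of_mem _ hg, by rwa [mem_closedBall, Real.dist_eq]⟩
    refine (hζ.dist_le_of_image_subset (continuousOn_of_local_lipschitz hδ hp) _ (by positivity)
      hcov hx hy).trans ?_
    have h1 : ((G.image p).card : ℝ) ≤ d * ((2 * K + 2) * m) :=
      le_trans (by exact_mod_cast Finset.card_image_le) hGcard
    have h2 : ((2 * K + 2) * (1 / K) : ℝ) ≤ 4 := by
      rw [mul_one_div, div_le_iff₀ hK0]; linarith
    calc ((G.image p).card : ℝ) * (2 * (1 / K)) ≤ d * ((2 * K + 2) * m) * (2 * (1 / K)) := by gcongr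
      _ = 2 * d * m * ((2 * K + 2) * (1 / K)) := by ring
      _ ≤ 2 * d * m * 4 := by gcongr
      _ ≤ 8 * d * m + 2 := by linarith
  · push Not at hall
    obtain ⟨z, hz, hzG⟩ := hall
    have h1 : ∀ y ∈ ζ, |p z - p y| ≤ 1 / K := by
      refine (hnear z hz).resolve_right ?_
      rintro ⟨g, hg, h⟩
      exact absurd h (not_le.2 (hzG g hg))
    have hzx := abs_le.1 (h1 x hx)
    have hzy := abs_le.1 (h1 y hy)
    rw [abs_le]
    constructor <;> linarith

namespace MvPolynomial

/-- The restriction of a polynomial to the hyperplane where the first coordinate is `c`. -/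
noncomputable def slice {n : ℕ} (c : ℝ) (F : MvPolynomial (Fin (n + 1)) ℝ) :
    MvPolynomial (Fin n) ℝ :=
  bind₁ (Fin.cons (C c) X : Fin (n + 1) → MvPolynomial (Fin n) ℝ) F

theorem eval_slice {n : ℕ} (c : ℝ) (F : MvPolynomial (Fin (n + 1)) ℝ) (x : Fin n → ℝ) :
    eval x (slice c F) = eval (Fin.cons c x : Fin (n + 1) → ℝ) F := by
  rw [slice, ← coe_aeval_eq_eval, RingHom.coe_coe, aeval_bind₁, ← coe_aeval_eq_eval,
    RingHom.coe_coe]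
  congr 2
  funext i
  refine Fin.cases ?_ (fun i => ?_) i <;> simp

theorem totalDegree_slice_le {n : ℕ} (c : ℝ) (F : MvPolynomial (Fin (n + 1)) ℝ) :
    (slice c F).totalDegree ≤ F.totalDegree := by
  refine (totalDegree_bind₁_le (D := 1) _ F fun i => ?_).trans (by simp)
  refine Fin.cases ?_ (fun i => ?_) i <;> simp

theorem pderiv_slice {n : ℕ} (c : ℝ) (F : MvPolynomial (Fin (n + 1)) ℝ) (i : Fin n) :
    pderiv i (slice c F) = slice c (pderiv i.succ F) := by
  classical
  induction F using MvPolynomial.induction_on with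
  | C a => simp [slice]
  | add p q hp hq => simp only [slice, map_add] at hp hq ⊢; rw [hp, hq]
  | mul_X p j hp =>
    simp only [slice] at hp ⊢
    refine Fin.cases ?_ (fun j => ?_) j
    · simp [hp, pderiv_X, (Fin.succ_ne_zero _).symm]
    · simp only [map_mul, Derivation.leibniz, smul_eq_mul, map_add, hp, bind₁_X_right,
        Fin.cons_succ, pderiv_X, Pi.single_apply, Fin.succ_inj]
      split_ifs <;> simp

/-- Each point of a sublevel set can be joined, inside the hyperplane section through it, to a
point where the partial derivatives along the section are prescribed small numbers. -/
theorem exists_slice_critical {n : ℕ} (F : MvPolynomial (Fin (n + 1)) ℝ)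
    (hF : {x : Fin (n + 1) → ℝ | eval x F ≤ 1} ⊆ closedBall 0 1) {y : Fin (n + 1) → ℝ}
    (hy : eval y F < 1) : ∃ δ > 0, ∀ a : Fin n → ℝ, ‖a‖ < δ → ∃ Y : Set (Fin n → ℝ),
      IsPreconnected Y ∧ Y ⊆ {x | eval x (slice (y 0) F) < 1} ∧ Fin.tail y ∈ Y ∧
      ∃ z ∈ Y, ∀ i : Fin n, eval (Fin.cons (y 0) z : Fin (n + 1) → ℝ) (pderiv i.succ F) = a i := by
  set U : Set (Fin n → ℝ) := {x | eval x (slice (y 0) F) < 1} with hU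
  have hUo : IsOpen U := isOpen_lt (continuous_eval' _) continuous_const
  have hyU : Fin.tail y ∈ U := by
    rw [hU, mem_ofPred_eq, eval_slice, Fin.cons_self_tail]; exact hy
  have hUb : U ⊆ closedBall 0 1 := by
    intro x hx
    have h1 : (Fin.cons (y 0) x : Fin (n + 1) → ℝ) ∈ closedBall (0 : Fin (n + 1) → ℝ) 1 := hF (by
      have : eval x (slice (y 0) F) < 1 := hx
      rw [eval_slice] at this
      exact this.le)
    rw [mem_closedBall_zero_iff] at h1 ⊢
    refine (pi_norm_le_iff_of_nonneg zero_le_one).2 fun i => ?_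
    exact (norm_le_pi_norm (Fin.cons (y 0) x : Fin (n + 1) → ℝ) i.succ).trans h1
  set Y := connectedComponentIn U (Fin.tail y) with hY
  have hYo : IsOpen Y := hUo.connectedComponentIn
  have hYU : Y ⊆ U := connectedComponentIn_subset _ _
  have hyY : Fin.tail y ∈ Y := mem_connectedComponentIn hyU
  obtain ⟨δ, hδ, h⟩ := exists_forall_pderiv_eq (slice (y 0) F) hYo
    (isBounded_closedBall.subset (hYU.trans hUb)) hyY (b := 1) hyU fun x hx => by
      by_contra! hlt
      rw [hYo.frontier_eq] at hx
      have hxU : x ∈ U := hlt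
      obtain ⟨w, hw1, hw2⟩ := mem_closure_iff.1 hx.1 _ hUo.connectedComponentIn
        (mem_connectedComponentIn hxU)
      apply hx.2
      rw [hY, connectedComponentIn_eq hw2, ← connectedComponentIn_eq hw1]
      exact mem_connectedComponentIn hxU
  refine ⟨δ, hδ, fun a ha => ⟨Y, isPreconnected_connectedComponentIn, hYU, hyY, ?_⟩⟩
  obtain ⟨z, hz, hza⟩ := h a ha
  refine ⟨z, hz, fun i => ?_⟩
  rw [← hza i, pderiv_slice, eval_slice]

end MvPolynomial

/-- If the image of a connected set has no large separated subsets, it is a short interval. -/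
theorem IsPreconnected.dist_le_of_packing {α : Type*} [TopologicalSpace α] {Y : Set α}
    (hY : IsPreconnected Y) {p : α → ℝ} (hp : ContinuousOn p Y) {N : ℕ} {L : ℝ} (hL : 0 ≤ L)
    (h : ∀ s : Finset α, (∀ x ∈ s, x ∈ Y) → (∀ x ∈ s, ∀ y ∈ s, x ≠ y → L < |p x - p y|) →
      s.card ≤ N) {x y : α} (hx : x ∈ Y) (hy : y ∈ Y) : |p x - p y| ≤ (N + 1) * (L + 1) := by
  classical
  wlog hxy : p y ≤ p x generalizing x y
  · rw [abs_sub_comm]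
    exact this hy hx (le_of_not_ge hxy)
  by_contra! hlt
  rw [abs_of_nonneg (sub_nonneg.2 hxy)] at hlt
  have hex : ∀ k : Fin (N + 1), ∃ w ∈ Y, p w = p y + k * (L + 1) := by
    intro k
    refine (hY.image p hp).Icc_subset ⟨y, hy, rfl⟩ ⟨x, hx, rfl⟩ ⟨?_, ?_⟩
    · have : 0 ≤ (k : ℝ) * (L + 1) := by positivity
      linarith
    · have h1 : ((k : ℕ) : ℝ) ≤ N + 1 := by exact_mod_cast k.2.le
      have := mul_le_mul_of_nonneg_right h1 (by linarith : 0 ≤ L + 1)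
      linarith
  choose w hwY hw using hex
  have hsep : ∀ k l, k ≠ l → L < |p (w k) - p (w l)| := by
    intro k l hkl
    rw [hw, hw, add_sub_add_left_eq_sub, ← sub_mul, abs_mul, abs_of_pos (by linarith : 0 < L + 1)]
    have h1 : (1 : ℝ) ≤ |((k : ℕ) : ℝ) - (l : ℕ)| := by
      have : (1 : ℤ) ≤ |((k : ℕ) : ℤ) - (l : ℕ)| :=
        Int.one_le_abs (sub_ne_zero.2 fun h => hkl (Fin.ext (by exact_mod_cast h)))
      exact_mod_cast this
    nlinarith
  have hinj : Function.Injective w := fun k l hkl => by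
    by_contra hne
    have := hsep k l hne
    rw [hkl] at this
    simp at this
    linarith
  have := h (Finset.univ.image w) (by simpa using hwY) (by
    simp only [Finset.mem_image, Finset.mem_univ, true_and]
    rintro _ ⟨k, rfl⟩ _ ⟨l, rfl⟩ hkl
    exact hsep k l fun h => hkl (by rw [h]))
  rw [Finset.card_image_of_injective _ hinj, Finset.card_fin] at this
  omega

namespace MvPolynomial

/-- The generic polar curve of a polynomial meets generic coordinate hyperplanes in boundedly many
points. -/
theorem exists_polar_curve (n D : ℕ) : ∃ m : ℕ, ∀ F : MvPolynomial (Fin (n + 1)) ℝ,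
    F.totalDegree ≤ D → ∀ δ > 0, ∃ a : Fin n → ℝ, ‖a‖ < δ ∧ ∃ B : Fin (n + 1) → Finset ℝ,
      ∀ i, ∀ c ∉ B i, ∃ t : Finset (Fin (n + 1) → ℝ), t.card ≤ m ∧
        ∀ x, (∀ j : Fin n, eval x (pderiv j.succ F) = a j) → x i = c → x ∈ t := by
  classical
  obtain ⟨m, hm⟩ := exists_fibre_card_le (n + 1) (D + 1)
  refine ⟨m, fun F hF δ hδ => ?_⟩
  have hQ : ∀ i : Fin (n + 1), _ := fun i =>
    hm (Fin.cons (X i) fun j : Fin n => pderiv j.succ F) fun k => by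
      refine Fin.cases ?_ (fun j => ?_) k
      · simp
      · simpa using ((totalDegree_pderiv_le F j.succ).trans hF).trans (Nat.le_succ D)
  choose Q hQ0 hQ using hQ
  obtain ⟨b, hb, hbQ⟩ := exists_norm_lt_eval_ne_zero
    (Finset.prod_ne_zero_iff.2 fun i (_ : i ∈ Finset.univ) => hQ0 i) hδ
  rw [map_prod, Finset.prod_ne_zero_iff] at hbQ
  let R : Fin (n + 1) → Polynomial ℝ := fun i => (finSuccEquiv ℝ n (Q i)).map (eval (Fin.tail b))
  have hR : ∀ i c, eval (Fin.cons c (Fin.tail b) : Fin (n + 1) → ℝ) (Q i) = (R i).eval c :=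
    fun i c => eval_eq_eval_mv_eval' _ _ _
  have hR0 : ∀ i, R i ≠ 0 := fun i h => by
    have h1 := hR i (b 0)
    rw [Fin.cons_self_tail, h, Polynomial.eval_zero] at h1
    exact hbQ i (Finset.mem_univ i) h1
  refine ⟨Fin.tail b, ?_, fun i => (R i).roots.toFinset, fun i c hc => ?_⟩
  · refine lt_of_le_of_lt ?_ hb
    exact (pi_norm_le_iff_of_nonneg (norm_nonneg _)).2 fun i => norm_le_pi_norm b i.succ
  · rw [Multiset.mem_toFinset, Polynomial.mem_roots (hR0 i), Polynomial.IsRoot, ← hR] at hc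
    obtain ⟨t, ht, htm⟩ := hQ i _ hc
    refine ⟨t, ht, fun x hx hxi => htm x fun k => ?_⟩
    refine Fin.cases ?_ (fun j => ?_) k
    · simpa using hxi
    · simpa using hx j

/-- A bounded sublevel set of a polynomial is covered by boundedly many pieces of bounded intrinsic
diameter, in the sense that a locally `1`-Lipschitz function on it takes boundedly many separated
values. -/
theorem exists_packing_bound (n D : ℕ) : ∃ N : ℕ, ∃ L : ℝ, 0 ≤ L ∧ ∀ F : MvPolynomial (Fin n) ℝ,
    F.totalDegree ≤ D → {x : Fin n → ℝ | eval x F ≤ 1} ⊆ closedBall 0 1 →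
    ∀ (p : (Fin n → ℝ) → ℝ) (δ : ℝ), 0 < δ →
      (∀ x y, eval x F ≤ 1 → eval y F ≤ 1 → ‖x - y‖ ≤ δ → |p x - p y| ≤ ‖x - y‖) →
      ∀ s : Finset (Fin n → ℝ), (∀ x ∈ s, eval x F < 1) →
        (∀ x ∈ s, ∀ y ∈ s, x ≠ y → L < |p x - p y|) → s.card ≤ N := by
  classical
  induction n with
  | zero =>
    exact ⟨1, 0, le_rfl, fun F _ _ p δ _ _ s _ _ =>
      Finset.card_le_one.2 fun _ _ _ _ => Subsingleton.elim _ _⟩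
  | succ n ih =>
    obtain ⟨N, L, hL, ih⟩ := ih
    obtain ⟨m, hm⟩ := exists_polar_curve n D
    obtain ⟨M, hM⟩ := exists_card_components_le (n + 1) (2 * D)
    set R₁ : ℝ := (N + 1) * (L + 1) with hR₁
    set R₂ : ℝ := 8 * (n + 1 : ℕ) * m + 2 with hR₂
    have hR₁0 : 0 ≤ R₁ := by positivity
    have hR₂0 : 0 ≤ R₂ := by positivity
    refine ⟨M, 2 * R₁ + R₂, by positivity, fun F hF hb p δ hδ hp s hs hsep => ?_⟩
    have hslice : ∀ c, ∀ Y : Set (Fin n → ℝ), IsPreconnected Y →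
        Y ⊆ {x | eval x (slice c F) < 1} → ∀ x ∈ Y, ∀ y ∈ Y,
        |p (Fin.cons c x : Fin (n + 1) → ℝ) - p (Fin.cons c y : Fin (n + 1) → ℝ)| ≤ R₁ := by
      intro c Y hY hYF x hx y hy
      have hnorm : ∀ x y : Fin n → ℝ,
          ‖(Fin.cons c x : Fin (n + 1) → ℝ) - (Fin.cons c y : Fin (n + 1) → ℝ)‖ ≤ ‖x - y‖ := by
        intro x y
        refine (pi_norm_le_iff_of_nonneg (norm_nonneg _)).2 fun i => ?_
        refine Fin.cases ?_ (fun i => ?_) i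
        · simp
        · simpa using norm_le_pi_norm (x - y) i
      have hp' : ∀ x y, eval x (slice c F) ≤ 1 → eval y (slice c F) ≤ 1 → ‖x - y‖ ≤ δ →
          |p (Fin.cons c x : Fin (n + 1) → ℝ) - p (Fin.cons c y : Fin (n + 1) → ℝ)| ≤ ‖x - y‖ := by
        intro x y hx hy hxy
        rw [eval_slice] at hx hy
        exact (hp _ _ hx hy ((hnorm x y).trans hxy)).trans (hnorm x y)
      refine hY.dist_le_of_packing (p := fun x => p (Fin.cons c x : Fin (n + 1) → ℝ)) ?_ hL
        (fun t htY ht => ?_) hx hy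
      · exact continuousOn_of_local_lipschitz hδ fun x hx y hy => hp' x y (hYF hx).le (hYF hy).le
      · refine ih (slice c F) ((totalDegree_slice_le c F).trans hF) ?_ _ δ hδ hp' t
          (fun x hx => hYF (htY x hx)) ht
        intro x hx
        rw [mem_ofPred_eq, eval_slice] at hx
        have h1 := mem_closedBall_zero_iff.1 (hb hx)
        rw [mem_closedBall_zero_iff]
        exact (pi_norm_le_iff_of_nonneg zero_le_one).2 fun i =>
          (norm_le_pi_norm (Fin.cons c x : Fin (n + 1) → ℝ) i.succ).trans h1
    have hz : ∃ ρ > 0, ∀ y ∈ s, ∀ a : Fin n → ℝ, ‖a‖ < ρ → ∃ z : Fin (n + 1) → ℝ,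
        eval z F < 1 ∧ (∀ i : Fin n, eval z (pderiv i.succ F) = a i) ∧ |p y - p z| ≤ R₁ := by
      refine s.exists_pos_forall_of_antitone
        (fun y ρ => ∀ a : Fin n → ℝ, ‖a‖ < ρ → ∃ z : Fin (n + 1) → ℝ,
        eval z F < 1 ∧ (∀ i : Fin n, eval z (pderiv i.succ F) = a i) ∧ |p y - p z| ≤ R₁)
        (fun y r r' hr h a ha => h a (ha.trans_le hr)) fun y hy => ?_
      obtain ⟨ρ, hρ, h⟩ := exists_slice_critical F hb (hs y hy)
      refine ⟨ρ, hρ, fun a ha => ?_⟩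
      obtain ⟨Y, hY, hYF, hyY, z, hz, hza⟩ := h a ha
      refine ⟨_, ?_, hza, ?_⟩
      · have : eval z (slice (y 0) F) < 1 := hYF hz
        rwa [eval_slice] at this
      · have := hslice (y 0) Y hY hYF _ hyY _ hz
        rwa [Fin.cons_self_tail] at this
    obtain ⟨ρ, hρ, hz⟩ := hz
    obtain ⟨a, ha, B, hB⟩ := hm F hF ρ hρ
    have hz' : ∀ y, ∃ z : Fin (n + 1) → ℝ, y ∈ s →
        eval z F < 1 ∧ (∀ i : Fin n, eval z (pderiv i.succ F) = a i) ∧ |p y - p z| ≤ R₁ := by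
      intro y
      by_cases hy : y ∈ s
      · obtain ⟨z, h⟩ := hz y hy a ha
        exact ⟨z, fun _ => h⟩
      · exact ⟨0, fun h => absurd h hy⟩
    choose z hz' using hz'
    let g : MvPolynomial (Fin (n + 1)) ℝ := ∑ j : Fin n, (pderiv j.succ F - C (a j)) ^ 2
    have hg : ∀ x, eval x g = ∑ j : Fin n, (eval x (pderiv j.succ F) - a j) ^ 2 := by simp [g]
    have hg0 : ∀ x, eval x g = 0 ↔ ∀ j : Fin n, eval x (pderiv j.succ F) = a j := by
      intro x
      rw [hg, Finset.sum_eq_zero_iff_of_nonneg fun _ _ => sq_nonneg _]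
      simp [sub_eq_zero]
    have hgd : g.totalDegree ≤ 2 * D := by
      refine totalDegree_finsetSum_le fun j _ => (totalDegree_pow _ _).trans ?_
      refine Nat.mul_le_mul_left _ ((totalDegree_sub_C_le _ _).trans ?_)
      exact (totalDegree_pderiv_le F _).trans hF
    have hdiff : ∀ y ∈ s, ∀ y' ∈ s, y ≠ y' → R₂ < |p (z y) - p (z y')| := by
      intro y hy y' hy' hne
      have h1 := hsep y hy y' hy' hne
      have h2 := (hz' y hy).2.2
      have h3 := (hz' y' hy').2.2
      have h4 : |p y - p y'| ≤ |p y - p (z y)| + |p (z y) - p (z y')| + |p y' - p (z y')| := by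
        rw [abs_sub_comm (p y')]
        calc |p y - p y'| = |(p y - p (z y)) + (p (z y) - p (z y')) + (p (z y') - p y')| := by
              congr 1; ring
          _ ≤ _ := abs_add_three _ _ _
      linarith
    have hinj : Set.InjOn z s := by
      intro y hy y' hy' h
      by_contra hne
      have := hdiff y hy y' hy' hne
      rw [h, sub_self, abs_zero] at this
      linarith
    rw [← Finset.card_image_of_injOn hinj]
    refine hM F g (hF.trans (by omega)) hgd hb
      (fun x => by rw [hg]; exact Finset.sum_nonneg fun _ _ => sq_nonneg _) _ ?_ ?_
    · simp only [Finset.mem_image]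
      rintro _ ⟨y, hy, rfl⟩
      exact ⟨(hz' y hy).1, (hg0 _).2 (hz' y hy).2.1⟩
    · simp only [Finset.mem_image]
      rintro _ ⟨y, hy, rfl⟩ _ ⟨y', hy', rfl⟩ hne ⟨ζ, hζ, hconn, h1, h2⟩
      refine absurd (hconn.dist_le_of_hyperplane_sections (fun x hx => hb (hζ hx).1) B (m := m)
        (fun i c hc => ?_) hδ (fun x hx y hy => hp x y (hζ hx).1 (hζ hy).1) _ h1 _ h2)
        (not_le.2 (hdiff y hy y' hy' fun h => hne (by rw [h])))
      obtain ⟨t, ht, htm⟩ := hB i c hc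
      exact ⟨t, ht, fun x hx => htm x ((hg0 x).1 (hζ hx).2)⟩

end MvPolynomial

namespace MvPolynomial

/-- A polynomial is locally Lipschitz near points where its gradient is small, uniformly on the
unit cube. -/
theorem exists_lipschitz_of_pderiv_le {n : ℕ} (q : MvPolynomial (Fin n) ℝ) {γ Γ : ℝ} (hγ : 0 < γ) :
    ∃ δ : ℝ, 0 < δ ∧ ∀ x ∈ closedBall (0 : Fin n → ℝ) 1, ∀ y ∈ closedBall (0 : Fin n → ℝ) 1,
      (∀ i, |eval x (pderiv i q)| ≤ Γ) → ‖x - y‖ ≤ δ →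
        |eval x q - eval y q| ≤ n * (Γ + γ) * ‖x - y‖ := by
  have hcont : ContinuousOn (fun x : Fin n → ℝ => fun i => eval x (pderiv i q))
      (closedBall (0 : Fin n → ℝ) 1) :=
    (continuous_pi fun i => continuous_eval' (pderiv i q)).continuousOn
  obtain ⟨δ, hδ, h⟩ := Metric.uniformContinuousOn_iff.1
    ((isCompact_closedBall _ _).uniformContinuousOn_of_continuous hcont) γ hγ
  refine ⟨δ / 2, by positivity, fun x hx y hy hΓ hxy => ?_⟩
  have hseg : Convex ℝ (closedBall (0 : Fin n → ℝ) 1 ∩ ball x δ) :=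
    (convex_closedBall _ _).inter (convex_ball _ _)
  have hle := hseg.norm_image_sub_le_of_norm_hasFDerivWithin_le (C := n * (Γ + γ))
    (f := fun y => eval y q) (fun z _ => (hasFDerivAt_eval q z).hasFDerivWithinAt) (fun z hz => ?_)
    (x := y) (y := x) ⟨hy, ?_⟩ ⟨hx, mem_ball_self hδ⟩
  · simpa using hle
  · have hi : ∀ i, |eval z (pderiv i q)| ≤ Γ + γ := fun i => by
      have h1 := (dist_le_pi_dist _ _ i).trans (h z hz.1 x hx hz.2).le
      rw [Real.dist_eq] at h1
      have h2 := abs_add_le (eval z (pderiv i q) - eval x (pderiv i q)) (eval x (pderiv i q))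
      rw [sub_add_cancel] at h2
      linarith [hΓ i]
    refine (norm_sum_le _ _).trans ?_
    calc _ ≤ ∑ _i : Fin n, (Γ + γ) := Finset.sum_le_sum fun i _ => by
          rw [norm_smul]
          refine (mul_le_of_le_one_right (norm_nonneg _) ?_).trans (hi i)
          refine ContinuousLinearMap.opNorm_le_bound _ zero_le_one fun v => ?_
          simpa using norm_le_pi_norm v i
      _ = _ := by simp; ring
  · rw [mem_ball, dist_comm, dist_eq_norm]
    linarith

/-- The values of a polynomial of bounded degree at points of the ball of radius `1 / 2` where
the gradient is at most `γ` have packing number at scale `γ` bounded in terms of the degree. -/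
theorem exists_packing_bound_near_critical (n D : ℕ) : ∃ N : ℕ, ∃ A : ℝ, 0 ≤ A ∧
    ∀ q : MvPolynomial (Fin n) ℝ, q.totalDegree ≤ D → ∀ γ : ℝ, 0 < γ →
      ∀ s : Finset (Fin n → ℝ), (∀ y ∈ s, ∑ i, y i ^ 2 ≤ 1 / 4) →
        (∀ y ∈ s, ∀ i, |eval y (pderiv i q)| ≤ γ) →
        (∀ x ∈ s, ∀ y ∈ s, x ≠ y → A * γ < |eval x q - eval y q|) → s.card ≤ N := by
  obtain ⟨N, L, hL, hN⟩ := exists_packing_bound n (2 * D + 2)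
  refine ⟨N, L * ((n + 1) * (2 * n + 3)), by positivity, fun q hq γ hγ s hs hgrad hsep => ?_⟩
  set F : MvPolynomial (Fin n) ℝ :=
    C (1 / (4 * (n + 1) * γ ^ 2)) * ∑ i, pderiv i q ^ 2 + ∑ i, X i ^ 2 with hF
  have heval : ∀ x, eval x F = 1 / (4 * (n + 1) * γ ^ 2) * ∑ i, eval x (pderiv i q) ^ 2
      + ∑ i, x i ^ 2 := fun x => by simp [hF]
  have hdeg : F.totalDegree ≤ 2 * D + 2 := by
    refine (totalDegree_add _ _).trans (max_le ?_ ?_)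
    · refine (totalDegree_mul _ _).trans ?_
      rw [totalDegree_C, zero_add]
      refine totalDegree_finsetSum_le fun i _ => (totalDegree_pow _ _).trans ?_
      have := totalDegree_pderiv_le q i
      omega
    · refine totalDegree_finsetSum_le fun i _ => (totalDegree_pow _ _).trans ?_
      rw [totalDegree_X]
      omega
  have hball : {x : Fin n → ℝ | eval x F ≤ 1} ⊆ closedBall 0 1 := fun x hx => by
    rw [mem_ofPred_eq, heval] at hx
    rw [mem_closedBall_zero_iff, pi_norm_le_iff_of_nonneg zero_le_one]
    intro i
    have h1 : x i ^ 2 ≤ ∑ j, x j ^ 2 :=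
      Finset.single_le_sum (f := fun j => x j ^ 2) (fun j _ => sq_nonneg _) (Finset.mem_univ i)
    have h2 : 0 ≤ 1 / (4 * (n + 1) * γ ^ 2) * ∑ i, eval x (pderiv i q) ^ 2 := by positivity
    rw [Real.norm_eq_abs]
    exact abs_le_one_iff_mul_self_le_one.2 (by nlinarith)
  have hsmall : ∀ x, eval x F ≤ 1 → ∀ i, |eval x (pderiv i q)| ≤ 2 * (n + 1) * γ :=
    fun x hx i => by
      rw [heval] at hx
      have h1 : eval x (pderiv i q) ^ 2 ≤ ∑ j, eval x (pderiv j q) ^ 2 :=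
        Finset.single_le_sum (f := fun j => eval x (pderiv j q) ^ 2) (fun j _ => sq_nonneg _)
          (Finset.mem_univ i)
      have h2 : 0 ≤ ∑ i, x i ^ 2 := by positivity
      have h3 : 1 / (4 * (n + 1) * γ ^ 2) * ∑ i, eval x (pderiv i q) ^ 2 ≤ 1 := by linarith
      rw [one_div, inv_mul_le_iff₀ (by positivity), mul_one] at h3
      refine abs_le_of_sq_le_sq (h1.trans (h3.trans ?_)) (by positivity)
      have : (0 : ℝ) ≤ n * (n + 1) * γ ^ 2 := by positivity
      nlinarith
  set K : ℝ := (n + 1) * (2 * n + 3) * γ with hK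
  have hKpos : 0 < K := by positivity
  obtain ⟨δ, hδ, hlip⟩ := exists_lipschitz_of_pderiv_le q (Γ := 2 * (n + 1) * γ) hγ
  have habs : ∀ x y, |eval x q / K - eval y q / K| = |eval x q - eval y q| / K := fun x y => by
    rw [← sub_div, abs_div, abs_of_pos hKpos]
  refine hN F hdeg hball (fun x => eval x q / K) δ hδ (fun x y hx hy hxy => ?_) s
    (fun x hx => ?_) fun x hx y hy hxy => ?_
  · rw [habs, div_le_iff₀ hKpos]
    refine (hlip x (hball hx) y (hball hy) (hsmall x hx) hxy).trans ?_
    rw [mul_comm ‖x - y‖]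
    refine mul_le_mul_of_nonneg_right ?_ (norm_nonneg _)
    have : (0 : ℝ) ≤ (2 * n + 3) * γ := by positivity
    rw [hK]
    nlinarith
  · rw [heval]
    have h1 : ∑ i, eval x (pderiv i q) ^ 2 ≤ ∑ _i : Fin n, γ ^ 2 :=
      Finset.sum_le_sum fun i _ => sq_le_sq' (abs_le.1 (hgrad x hx i)).1 (abs_le.1 (hgrad x hx i)).2
    have h2 : 1 / (4 * (n + 1) * γ ^ 2) * ∑ i, eval x (pderiv i q) ^ 2 ≤ 1 / 4 := by
      rw [one_div, inv_mul_le_iff₀ (by positivity)]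
      refine h1.trans ?_
      simp only [Finset.sum_const, Finset.card_univ, Fintype.card_fin, nsmul_eq_mul]
      nlinarith [sq_nonneg γ]
    linarith [hs x hx]
  · rw [habs, lt_div_iff₀ hKpos]
    refine lt_of_le_of_lt (le_of_eq ?_) (hsep x hx y hy hxy)
    rw [hK]
    ring

end MvPolynomial

universe u

section Taylor

variable {E : Type u} [NormedAddCommGroup E] [NormedSpace ℝ E] {s : Set E}

/-- When all arguments but one coincide, the remaining argument of an iterated derivative may be
moved to the last place. -/
theorem ContDiffOn.iteratedFDerivWithin_succ_update_const {F : Type u} [NormedAddCommGroup F]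
    [NormedSpace ℝ F] {f : E → F} {k : ℕ} (hf : ContDiffOn ℝ (k + 1) f s)
    (hs : UniqueDiffOn ℝ s) (hs' : s ⊆ closure (interior s)) {x : E} (hx : x ∈ s) (z v : E)
    (i : Fin (k + 1)) :
    iteratedFDerivWithin ℝ (k + 1) f s x (Function.update (fun _ => z) i v) =
      iteratedFDerivWithin ℝ k (fderivWithin ℝ f s) s x (fun _ => z) v := by
  induction k generalizing F with
  | zero =>
    obtain rfl : i = Fin.last 0 := Fin.ext (by omega)
    rw [iteratedFDerivWithin_succ_apply_right hs hx, Function.update_self, Fin.init_update_last]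
    rfl
  | succ k ih =>
    rw [iteratedFDerivWithin_succ_apply_right hs hx]
    refine Fin.lastCases ?_ (fun i => ?_) i
    · rw [Fin.init_update_last, Function.update_self]
      rfl
    · rw [Fin.init_update_castSucc, Function.update_of_ne (Fin.castSucc_lt_last i).ne']
      have hf' : ContDiffOn ℝ (k + 1) (fderivWithin ℝ f s) s :=
        hf.fderivWithin hs (by push_cast; rfl)
      have hinit : Fin.init (fun _ : Fin (k + 1 + 1) => z) = fun _ => z := rfl
      have hinit' : Fin.init (fun _ : Fin (k + 1) => z) = fun _ => z := rfl
      rw [hinit, ih hf', iteratedFDerivWithin_succ_apply_right hs hx, hinit']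
      set G := fderivWithin ℝ (fderivWithin ℝ f s) s
      let T := (ContinuousLinearMap.flipₗᵢ ℝ E E F).toContinuousLinearEquiv
      have hsymm : EqOn (T ∘ G) G s := fun y hy => by
        ext a b
        refine ContDiffWithinAt.isSymmSndFDerivWithinAt (hf y hy) ?_ hs (hs' hy) hy b a
        simp only [minSmoothness_of_isRCLikeNormedField]
        norm_cast
        omega
      have h1 := T.iteratedFDerivWithin_comp_left (G := E →L[ℝ] E →L[ℝ] F) G hs hx k
      rw [iteratedFDerivWithin_congr hsymm hx] at h1
      have h2 := congrArg (fun P => P (fun _ => z) v z) h1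
      exact h2

/-- The Taylor polynomial of order `d`, that is of degree less than `d`. -/
noncomputable def taylorSum {F : Type u} [NormedAddCommGroup F] [NormedSpace ℝ F] (d : ℕ)
    (f : E → F) (s : Set E) (x₀ x : E) : F :=
  ∑ k ∈ Finset.range d, ((k.factorial : ℝ)⁻¹) •
    iteratedFDerivWithin ℝ k f s x₀ (fun _ => x - x₀)

/-- The derivative of the Taylor polynomial is the Taylor polynomial of the derivative. -/
theorem ContDiffOn.hasFDerivAt_taylorSum {F : Type u} [NormedAddCommGroup F]
    [NormedSpace ℝ F] {f : E → F} {d : ℕ} (hf : ContDiffOn ℝ (d + 1) f s)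
    (hs : UniqueDiffOn ℝ s) (hs' : s ⊆ closure (interior s)) {x₀ : E} (hx₀ : x₀ ∈ s) (x : E) :
    HasFDerivAt (taylorSum (d + 1) f s x₀) (taylorSum d (fderivWithin ℝ f s) s x₀ x) x := by
  have hterm : ∀ k ∈ Finset.range d, HasFDerivAt
      (fun x => (((k + 1).factorial : ℝ)⁻¹) •
        iteratedFDerivWithin ℝ (k + 1) f s x₀ (fun _ => x - x₀))
      (((k.factorial : ℝ)⁻¹) •
        iteratedFDerivWithin ℝ k (fderivWithin ℝ f s) s x₀ (fun _ => x - x₀)) x := by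
    intro k hk
    have hin : HasFDerivAt (fun x : E => fun _ : Fin (k + 1) => x - x₀)
        (ContinuousLinearMap.pi fun _ => ContinuousLinearMap.id ℝ E) x :=
      hasFDerivAt_pi.2 fun _ => (hasFDerivAt_id x).sub_const x₀
    have h := (((iteratedFDerivWithin ℝ (k + 1) f s x₀).hasFDerivAt
      (x := fun _ => x - x₀)).comp x hin).const_smul (((k + 1).factorial : ℝ)⁻¹)
    refine h.congr_fderiv ?_
    have hfk : ContDiffOn ℝ (k + 1) f s := hf.of_le (by
      have := Finset.mem_range.1 hk
      norm_cast
      omega)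
    ext v
    simp only [smul_apply, ContinuousLinearMap.comp_apply,
      ContinuousMultilinearMap.linearDeriv_apply, ContinuousLinearMap.pi_apply,
      ContinuousLinearMap.id_apply, hfk.iteratedFDerivWithin_succ_update_const hs hs' hx₀]
    rw [Finset.sum_const, Finset.card_univ, Fintype.card_fin, ← Nat.cast_smul_eq_nsmul ℝ, smul_smul,
      Nat.factorial_succ]
    congr 1
    push_cast
    have : (k.factorial : ℝ) ≠ 0 := by positivity
    field_simp
  have hsum := (HasFDerivAt.fun_sum hterm).add_const (f x₀)
  refine hsum.congr_of_eventuallyEq (Filter.Eventually.of_forall fun y => ?_)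
  simp [taylorSum, Finset.sum_range_succ']

theorem taylorSum_succ_self {F : Type u} [NormedAddCommGroup F] [NormedSpace ℝ F] (d : ℕ)
    (f : E → F) (s : Set E) (x₀ : E) : taylorSum (d + 1) f s x₀ x₀ = f x₀ := by
  rw [taylorSum, Finset.sum_range_succ', Finset.sum_eq_zero, zero_add]
  · simp
  · intro k _
    rw [ContinuousMultilinearMap.map_coord_zero _ 0 (sub_self _), smul_zero]

/-- Taylor's theorem on a convex set, for maps between normed spaces. -/
theorem ContDiffOn.norm_sub_taylorSum_le {F : Type u} [NormedAddCommGroup F]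
    [NormedSpace ℝ F] {f : E → F} {d : ℕ} (hf : ContDiffOn ℝ d f s) (hc : Convex ℝ s)
    (hs : UniqueDiffOn ℝ s) (hs' : s ⊆ closure (interior s)) {M : ℝ}
    (hM : ∀ x ∈ s, ‖iteratedFDerivWithin ℝ d f s x‖ ≤ M) {x₀ : E} (hx₀ : x₀ ∈ s) {x : E}
    (hx : x ∈ s) : ‖f x - taylorSum d f s x₀ x‖ ≤ M * ‖x - x₀‖ ^ d := by
  induction d generalizing F x with
  | zero => simpa [taylorSum] using hM x hx
  | succ d ih =>
    push_cast at hf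
    have hM0 : 0 ≤ M := (norm_nonneg _).trans (hM x hx)
    have hd : DifferentiableOn ℝ f s := hf.differentiableOn (by simp)
    have key := (hc.inter (convex_closedBall x₀ ‖x - x₀‖)).norm_image_sub_le_of_norm_hasFDerivWithin_le
      (f := fun y => f y - taylorSum (d + 1) f s x₀ y)
      (f' := fun y => fderivWithin ℝ f s y - taylorSum d (fderivWithin ℝ f s) s x₀ y)
      (C := M * ‖x - x₀‖ ^ d) (x := x₀) (y := x)
      (fun y hy => ((hd y hy.1).hasFDerivWithinAt.sub
        (hf.hasFDerivAt_taylorSum hs hs' hx₀ y).hasFDerivWithinAt).mono inter_subset_left)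
      (fun y hy => ?_) ⟨hx₀, by simp⟩ ⟨hx, by simp [dist_eq_norm]⟩
    · simpa [taylorSum_succ_self, pow_succ, mul_assoc] using key
    · refine (ih (hf.fderivWithin hs le_rfl) (fun z hz => ?_) hy.1).trans ?_
      · rw [norm_iteratedFDerivWithin_fderivWithin hs hz]
        exact hM z hz
      · have := hy.2
        rw [mem_closedBall, dist_eq_norm] at this
        gcongr

end Taylor

namespace MvPolynomial

/-- The diagonal of a multilinear form is a polynomial in the coordinates. -/
theorem exists_eval_eq_multilinear {n k : ℕ}
    (P : ContinuousMultilinearMap ℝ (fun _ : Fin k => EuclideanSpace ℝ (Fin n)) ℝ) :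
    ∃ q : MvPolynomial (Fin n) ℝ, q.totalDegree ≤ k ∧
      ∀ z : EuclideanSpace ℝ (Fin n), eval z.ofLp q = P fun _ => z := by
  let b := EuclideanSpace.basisFun (Fin n) ℝ
  refine ⟨∑ r : Fin k → Fin n, C (P fun l => b (r l)) * ∏ l, X (r l), ?_, fun z => ?_⟩
  · refine totalDegree_finsetSum_le fun r _ => (totalDegree_mul _ _).trans ?_
    rw [totalDegree_C, zero_add]
    refine (totalDegree_finsetProd _ _).trans ?_
    simp [totalDegree_X]
  · have hz : z = ∑ i, z.ofLp i • b i := by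
      conv_lhs => rw [← b.sum_repr z]
      simp [b]
    conv_rhs => rw [hz]
    rw [P.map_sum]
    simp only [map_sum, map_mul, map_prod, eval_C, eval_X, ContinuousMultilinearMap.map_smul_univ,
      smul_eq_mul]
    exact Finset.sum_congr rfl fun r _ => mul_comm _ _

theorem exists_eval_eq_taylorSum {n : ℕ} (d : ℕ) (f : EuclideanSpace ℝ (Fin n) → ℝ)
    (s : Set (EuclideanSpace ℝ (Fin n))) (x₀ : EuclideanSpace ℝ (Fin n)) (c : ℝ) :
    ∃ q : MvPolynomial (Fin n) ℝ, q.totalDegree ≤ d ∧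
      ∀ y : Fin n → ℝ, eval y q = taylorSum d f s x₀ (x₀ + c • WithLp.toLp 2 y) := by
  choose P hdeg hP using fun k =>
    exists_eval_eq_multilinear (iteratedFDerivWithin ℝ k f s x₀)
  refine ⟨∑ k ∈ Finset.range d, C ((k.factorial : ℝ)⁻¹ * c ^ k) * P k, ?_, fun y => ?_⟩
  · refine totalDegree_finsetSum_le fun k hk => (totalDegree_mul _ _).trans ?_
    rw [totalDegree_C, zero_add]
    exact (hdeg k).trans (Finset.mem_range.1 hk).le
  · rw [taylorSum, map_sum]
    refine Finset.sum_congr rfl fun k _ => ?_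
    have h := (iteratedFDerivWithin ℝ k f s x₀).map_smul_univ (fun _ => c)
      (fun _ => WithLp.toLp 2 y)
    rw [add_sub_cancel_left, h, ← hP k]
    simp [mul_assoc]

/-- Near a point `x₀`, a `C^d` function is approximated by a polynomial of degree at most `d`, in
such a way that rescaled critical points are almost critical for the polynomial. -/
theorem exists_local_approximation {n d : ℕ} {f : EuclideanSpace ℝ (Fin n) → ℝ}
    {s : Set (EuclideanSpace ℝ (Fin n))} (hf : ContDiffOn ℝ (d + 1) f s) (hc : Convex ℝ s)
    (hs : UniqueDiffOn ℝ s) (hs' : s ⊆ closure (interior s)) {M : ℝ}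
    (hM : ∀ x ∈ s, ‖iteratedFDerivWithin ℝ (d + 1) f s x‖ ≤ M)
    {x₀ : EuclideanSpace ℝ (Fin n)} (hx₀ : x₀ ∈ s) {ρ : ℝ} (hρ : 0 < ρ) :
    ∃ q : MvPolynomial (Fin n) ℝ, q.totalDegree ≤ d + 1 ∧
      ∀ y : Fin n → ℝ, ∀ x ∈ s, x = x₀ + (2 * ρ) • WithLp.toLp 2 y → ‖x - x₀‖ ≤ ρ →
        |f x - eval y q| ≤ M * ρ ^ (d + 1) ∧
        (fderivWithin ℝ f s x = 0 → ∀ i, |eval y (pderiv i q)| ≤ 2 * (M * ρ ^ (d + 1))) := by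
  obtain ⟨q, hdeg, hq⟩ := exists_eval_eq_taylorSum (d + 1) f s x₀ (2 * ρ)
  have hM0 : 0 ≤ M := (norm_nonneg _).trans (hM x₀ hx₀)
  refine ⟨q, hdeg, fun y x hx hxy hle => ⟨?_, fun hcrit i => ?_⟩⟩
  · rw [hq, ← hxy]
    refine (hf.norm_sub_taylorSum_le (d := d + 1) hc hs hs' hM hx₀ hx).trans ?_
    gcongr
  · have hin : HasFDerivAt (fun y : Fin n → ℝ => x₀ + (2 * ρ) • WithLp.toLp 2 y)
        ((2 * ρ) • (EuclideanSpace.equiv (Fin n) ℝ).symm.toContinuousLinearMap) y :=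
      (((EuclideanSpace.equiv (Fin n) ℝ).symm.hasFDerivAt).const_smul (2 * ρ)).const_add x₀
    have hT : HasFDerivAt (taylorSum (d + 1) f s x₀)
        (taylorSum d (fderivWithin ℝ f s) s x₀ x) (x₀ + (2 * ρ) • WithLp.toLp 2 y) :=
      hxy ▸ hf.hasFDerivAt_taylorSum hs hs' hx₀ x
    have h := hT.comp y hin
    have huniq := (hasFDerivAt_eval q y).unique
      (h.congr_of_eventuallyEq (Filter.Eventually.of_forall hq))
    have happ := congrArg (fun P => P (Pi.single i 1)) huniq
    have hT' : ‖taylorSum d (fderivWithin ℝ f s) s x₀ x‖ ≤ M * ρ ^ d := by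
      have h1 := (hf.fderivWithin hs le_rfl).norm_sub_taylorSum_le hc hs hs' (M := M)
        (fun z hz => by rw [norm_iteratedFDerivWithin_fderivWithin hs hz]; exact hM z hz) hx₀ hx
      rw [hcrit, zero_sub, norm_neg] at h1
      exact h1.trans (by gcongr)
    have hsum : eval y (pderiv i q) = taylorSum d (fderivWithin ℝ f s) s x₀ x
        ((2 * ρ) • EuclideanSpace.single i (1 : ℝ)) := by
      simpa [Pi.single_apply] using happ
    rw [hsum, ← Real.norm_eq_abs]
    refine (ContinuousLinearMap.le_opNorm _ _).trans ?_
    rw [norm_smul, PiLp.norm_single, norm_one, mul_one, Real.norm_of_nonneg (by positivity)]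
    calc _ ≤ M * ρ ^ d * (2 * ρ) := by gcongr
      _ = _ := by ring

end MvPolynomial

/-- Critical points of a `C^(d+1)` function in a small ball have values with bounded packing
number at the scale of the Taylor remainder. -/
theorem exists_local_critical_packing_bound (n d : ℕ) : ∃ N : ℕ, ∃ A : ℝ, 0 ≤ A ∧
    ∀ (f : EuclideanSpace ℝ (Fin n) → ℝ) (s : Set (EuclideanSpace ℝ (Fin n))),
      ContDiffOn ℝ (d + 1) f s → Convex ℝ s → UniqueDiffOn ℝ s → s ⊆ closure (interior s) →
      ∀ M : ℝ, (∀ x ∈ s, ‖iteratedFDerivWithin ℝ (d + 1) f s x‖ ≤ M) →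
      ∀ ρ η : ℝ, 0 < ρ → 0 < η → M * ρ ^ (d + 1) ≤ η →
      ∀ t : Finset (EuclideanSpace ℝ (Fin n)),
        (∀ x ∈ t, x ∈ s ∧ fderivWithin ℝ f s x = 0) →
        (∀ x ∈ t, ∀ y ∈ t, ‖x - y‖ ≤ ρ) →
        (∀ x ∈ t, ∀ y ∈ t, x ≠ y → A * η < |f x - f y|) → t.card ≤ N := by
  classical
  obtain ⟨N, A, hA, hN⟩ := MvPolynomial.exists_packing_bound_near_critical n (d + 1)
  refine ⟨N, 2 * A + 2, by positivity,
    fun f s hf hc hs hs' M hM ρ η hρ hη hMη t hcrit hdiam hsep => ?_⟩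
  rcases t.eq_empty_or_nonempty with rfl | ⟨x₀, hx₀⟩
  · simp
  obtain ⟨q, hdeg, hq⟩ := MvPolynomial.exists_local_approximation hf hc hs hs' hM
    (hcrit x₀ hx₀).1 hρ
  let φ : EuclideanSpace ℝ (Fin n) → Fin n → ℝ := fun x => ((2 * ρ)⁻¹ • (x - x₀)).ofLp
  have hφ : ∀ x, x = x₀ + (2 * ρ) • WithLp.toLp 2 (φ x) := fun x => by
    have : (2 * ρ) • (2 * ρ)⁻¹ • (x - x₀) = x - x₀ := smul_inv_smul₀ (by positivity) _
    simp only [φ, WithLp.toLp_ofLp, this, add_sub_cancel]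
  have hinj : Function.Injective φ := fun x y hxy => by rw [hφ x, hφ y, hxy]
  have hq' : ∀ x ∈ t, |f x - MvPolynomial.eval (φ x) q| ≤ η ∧
      ∀ i, |MvPolynomial.eval (φ x) (MvPolynomial.pderiv i q)| ≤ 2 * η := fun x hx => by
    obtain ⟨h1, h2⟩ := hq (φ x) x (hcrit x hx).1 (hφ x) (hdiam x hx x₀ hx₀)
    exact ⟨h1.trans hMη, fun i => (h2 (hcrit x hx).2 i).trans (by gcongr)⟩
  rw [← Finset.card_image_of_injective t hinj]
  refine hN q hdeg (2 * η) (by positivity) _ ?_ ?_ ?_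
  · simp only [Finset.forall_mem_image]
    intro x hx
    have h1 : ∑ i, φ x i ^ 2 = ‖(2 * ρ)⁻¹ • (x - x₀)‖ ^ 2 := by
      rw [EuclideanSpace.real_norm_sq_eq]
    rw [h1, norm_smul, Real.norm_of_nonneg (by positivity)]
    have h2 : (2 * ρ)⁻¹ * ‖x - x₀‖ ≤ 1 / 2 := by
      rw [inv_mul_le_iff₀ (by positivity)]
      linarith [hdiam x hx x₀ hx₀]
    have h3 : 0 ≤ (2 * ρ)⁻¹ * ‖x - x₀‖ := by positivity
    nlinarith
  · simp only [Finset.forall_mem_image]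
    exact fun x hx => (hq' x hx).2
  · simp only [Finset.forall_mem_image]
    intro x hx y hy hxy
    have h1 := hsep x hx y hy fun h => hxy (h ▸ rfl)
    have h2 := (hq' x hx).1
    have h3 := (hq' y hy).1
    have h4 : |f x - f y| ≤ |f x - MvPolynomial.eval (φ x) q| +
        |MvPolynomial.eval (φ x) q - MvPolynomial.eval (φ y) q| +
        |f y - MvPolynomial.eval (φ y) q| := by
      rw [abs_sub_comm (f y)]
      refine (le_of_eq ?_).trans ((abs_add_le _ _).trans (add_le_add_left (abs_add_le _ _) _))
      congr 1
      ring
    linarith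

/-- A ball of radius `r` splits into at most `C (r / ρ) ^ n` pieces of diameter at most `ρ`. -/
theorem EuclideanSpace.exists_partition_closedBall (n : ℕ) {r ρ : ℝ} (hρ : 0 < ρ) (hρr : ρ ≤ r) :
    ∃ (T : Finset (Fin n → ℤ)) (l : EuclideanSpace ℝ (Fin n) → Fin n → ℤ),
      (T.card : ℝ) ≤ ((2 * n + 5) * (r / ρ)) ^ n ∧
      (∀ x ∈ closedBall (0 : EuclideanSpace ℝ (Fin n)) r, l x ∈ T) ∧
      ∀ x y, l x = l y → ‖x - y‖ ≤ ρ := by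
  have hr : 0 < r := hρ.trans_le hρr
  set m : ℕ := ⌈r * (n + 1) / ρ⌉₊ with hm
  refine ⟨Fintype.piFinset fun _ => Finset.Icc (-(m : ℤ)) m,
    fun x i => ⌊x i * (n + 1) / ρ⌋, ?_, fun x hx => ?_, fun x y hxy => ?_⟩
  · rw [Fintype.card_piFinset]
    simp only [Int.card_Icc, Finset.prod_const, Finset.card_univ, Fintype.card_fin]
    push_cast
    refine pow_le_pow_left₀ (by positivity) ?_ n
    have h1 : ((m : ℤ) + 1 - -(m : ℤ)).toNat = 2 * m + 1 := by omega
    rw [h1]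
    push_cast
    have h2 : (m : ℝ) < r * (n + 1) / ρ + 1 := Nat.ceil_lt_add_one (by positivity)
    have h3 : 1 ≤ r / ρ := (one_le_div hρ).2 hρr
    have h4 : r * (n + 1) / ρ = (n + 1) * (r / ρ) := by ring
    rw [h4] at h2
    linarith
  · rw [Fintype.mem_piFinset]
    intro i
    have h1 : |x i| ≤ r := by
      rw [← Real.norm_eq_abs]
      exact (PiLp.norm_apply_le x i).trans (by simpa using hx)
    have h2 : r * (n + 1) / ρ ≤ m := Nat.le_ceil _
    have h3 : x i * (n + 1) / ρ ≤ r * (n + 1) / ρ := by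
      gcongr
      exact (abs_le.1 h1).2
    have h4 : -(r * (n + 1) / ρ) ≤ x i * (n + 1) / ρ := by
      rw [← neg_div, ← neg_mul]
      gcongr
      exact (abs_le.1 h1).1
    rw [Finset.mem_Icc, Int.le_floor]
    push_cast
    refine ⟨by linarith, ?_⟩
    refine (Int.cast_le (R := ℝ)).1 ?_
    rw [Int.cast_natCast]
    exact (Int.floor_le _).trans (h3.trans h2)
  · have hi : ∀ i, ‖(x - y) i‖ ≤ ρ / (n + 1) := fun i => by
      have h := (Int.abs_sub_lt_one_of_floor_eq_floor (congrFun hxy i)).le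
      have h5 : x i * (n + 1) / ρ - y i * (n + 1) / ρ = (x i - y i) * ((n + 1) / ρ) := by ring
      rw [h5, abs_mul, abs_of_pos (by positivity : (0 : ℝ) < (n + 1) / ρ),
        ← le_div_iff₀ (by positivity), one_div_div] at h
      simpa using h
    rw [EuclideanSpace.norm_eq]
    refine Real.sqrt_le_iff.2 ⟨hρ.le, ?_⟩
    calc ∑ i, ‖(x - y) i‖ ^ 2 ≤ ∑ _i : Fin n, (ρ / (n + 1)) ^ 2 := by
          gcongr with i
          exact hi i
      _ = n / (n + 1) ^ 2 * ρ ^ 2 := by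
          rw [Finset.sum_const, Finset.card_univ, Fintype.card_fin, nsmul_eq_mul, div_pow]
          ring
      _ ≤ 1 * ρ ^ 2 := by
          gcongr
          rw [div_le_one (by positivity)]
          nlinarith [(Nat.cast_nonneg n : (0 : ℝ) ≤ n)]
      _ = ρ ^ 2 := one_mul _

/-- Critical points of a `C^(d+1)` function on a ball have values whose packing number at the scale
of the Taylor remainder over radius `ρ` is at most `C (r / ρ) ^ n`. -/
theorem exists_critical_packing_bound (n d : ℕ) : ∃ C : ℝ, 0 ≤ C ∧ ∃ A : ℝ, 0 ≤ A ∧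
    ∀ r : ℝ, 0 < r → ∀ f : EuclideanSpace ℝ (Fin n) → ℝ,
      ContDiffOn ℝ (d + 1) f (closedBall 0 r) →
      ∀ M : ℝ, (∀ x ∈ closedBall (0 : EuclideanSpace ℝ (Fin n)) r,
        ‖iteratedFDerivWithin ℝ (d + 1) f (closedBall 0 r) x‖ ≤ M) →
      ∀ ρ η : ℝ, 0 < ρ → ρ ≤ r → 0 < η → M * ρ ^ (d + 1) ≤ η →
      ∀ t : Finset ℝ, (t : Set ℝ) ⊆ f '' {x ∈ closedBall (0 : EuclideanSpace ℝ (Fin n)) r |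
          fderivWithin ℝ f (closedBall (0 : EuclideanSpace ℝ (Fin n)) r) x = 0} →
        (∀ u ∈ t, ∀ v ∈ t, u ≠ v → A * η < |u - v|) → (t.card : ℝ) ≤ C * (r / ρ) ^ n := by
  classical
  obtain ⟨N, A, hA, hN⟩ := exists_local_critical_packing_bound n d
  refine ⟨N * (2 * n + 5) ^ n, by positivity, A, hA,
    fun r hr f hf M hM ρ η hρ hρr hη hMη t ht hsep => ?_⟩
  obtain ⟨T, l, hT, hlT, hl⟩ := EuclideanSpace.exists_partition_closedBall n hρ hρr
  set B := closedBall (0 : EuclideanSpace ℝ (Fin n)) r with hB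
  have hconv : Convex ℝ B := convex_closedBall _ _
  have hinterior : interior B = ball 0 r := interior_closedBall _ hr.ne'
  have hclos : B ⊆ closure (interior B) := by rw [hinterior, closure_ball _ hr.ne']
  have huniq : UniqueDiffOn ℝ B :=
    uniqueDiffOn_convex hconv (by rw [hinterior]; exact nonempty_ball.2 hr)
  have hpre : ∀ u ∈ t, ∃ x : EuclideanSpace ℝ (Fin n),
      (x ∈ B ∧ fderivWithin ℝ f B x = 0) ∧ f x = u := fun u hu => ht hu
  choose! g hgB hgf using hpre
  have hcard : t.card ≤ N * T.card := by
    refine Finset.card_le_mul_card_image_of_maps_to (f := fun u => l (g u))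
      (fun u hu => hlT _ (hgB u hu).1) N fun a _ => ?_
    have hinj : InjOn g ({u ∈ t | l (g u) = a} : Finset ℝ) := fun u hu v hv huv => by
      rw [← hgf u (Finset.mem_filter.1 hu).1, huv, hgf v (Finset.mem_filter.1 hv).1]
    rw [← Finset.card_image_of_injOn hinj]
    refine hN f B hf hconv huniq hclos M hM ρ η hρ hη hMη _ ?_ ?_ ?_ <;>
      simp only [Finset.forall_mem_image, Finset.mem_filter]
    · exact fun u hu => hgB u hu.1
    · exact fun u hu v hv => hl _ _ (hu.2.trans hv.2.symm)
    · intro u hu v hv huv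
      rw [hgf u hu.1, hgf v hv.1]
      exact hsep u hu.1 v hv.1 fun h => huv (h ▸ rfl)
  calc (t.card : ℝ) ≤ N * T.card := by exact_mod_cast hcard
    _ ≤ N * ((2 * n + 5) * (r / ρ)) ^ n := by gcongr
    _ = _ := by rw [mul_pow, mul_assoc]

theorem coveringNumber_le_card {ε : ℝ} {S : Set ℝ} (t : Finset ℝ)
    (h : S ⊆ ⋃ c ∈ t, closedBall c ε) : coveringNumber ε S ≤ t.card :=
  Nat.sInf_le ⟨t, rfl, h⟩

/-- Bounds on packing numbers give bounds on covering numbers. -/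
theorem coveringNumber_le_of_packing {ε A K : ℝ} {S : Set ℝ} (hε : 0 < ε)
    (h : ∀ t : Finset ℝ, (t : Set ℝ) ⊆ S → (∀ u ∈ t, ∀ v ∈ t, u ≠ v → A * ε < |u - v|) →
      (t.card : ℝ) ≤ K) :
    (coveringNumber ε S : ℝ) ≤ K * (2 * ⌈A⌉₊ + 1) := by
  classical
  let P : Set ℕ := {k | ∃ t : Finset ℝ, (t : Set ℝ) ⊆ S ∧
    (∀ u ∈ t, ∀ v ∈ t, u ≠ v → A * ε < |u - v|) ∧ t.card = k}
  have hbdd : BddAbove P := by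
    refine ⟨⌊K⌋₊, ?_⟩
    rintro _ ⟨t, htS, ht, rfl⟩
    exact Nat.le_floor (h t htS ht)
  obtain ⟨t, htS, ht, htmax⟩ : sSup P ∈ P := Nat.sSup_mem ⟨0, ∅, by simp, by simp, by simp⟩ hbdd
  let a : ℕ := ⌈A⌉₊
  let U : Finset ℝ := t.biUnion fun c => (Finset.Icc (-(a : ℤ)) a).image fun j : ℤ => c + j * ε
  have hU : S ⊆ ⋃ c ∈ U, closedBall c ε := fun v hv => by
    obtain ⟨c, hc, hcv⟩ : ∃ c ∈ insert v t, c ∈ t ∧ |v - c| ≤ a * ε := by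
      by_contra! hcon
      have hAa : A * ε ≤ a * ε := by
        gcongr
        exact Nat.le_ceil A
      have hvt : v ∉ t := fun hvt => by
        have := hcon v (Finset.mem_insert_self _ _) hvt
        rw [sub_self, abs_zero] at this
        exact absurd this (not_lt.2 (by positivity))
      have hmem : t.card + 1 ∈ P := by
        refine ⟨insert v t, ?_, ?_, Finset.card_insert_of_notMem hvt⟩
        · rw [Finset.coe_insert]
          exact insert_subset hv htS
        · intro u hu w hw huw
          rcases Finset.mem_insert.1 hu with rfl | hu' <;>
            rcases Finset.mem_insert.1 hw with rfl | hw'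
          · exact absurd rfl huw
          · exact hAa.trans_lt (hcon w hw hw')
          · rw [abs_sub_comm]
            exact hAa.trans_lt (hcon u hu hu')
          · exact ht u hu' w hw' huw
      have := le_csSup hbdd hmem
      omega
    have hquot : |(v - c) / ε| ≤ a := by
      rw [abs_div, abs_of_pos hε, div_le_iff₀ hε]
      exact hcv.2
    refine mem_iUnion₂.2 ⟨c + ⌊(v - c) / ε⌋ * ε, Finset.mem_biUnion.2 ⟨c, hcv.1,
      Finset.mem_image.2 ⟨⌊(v - c) / ε⌋, Finset.mem_Icc.2 ⟨?_, ?_⟩, rfl⟩⟩, ?_⟩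
    · rw [Int.le_floor]
      push_cast
      exact (abs_le.1 hquot).1
    · exact_mod_cast (Int.floor_le _).trans (abs_le.1 hquot).2
    · have h1 : v - (c + ⌊(v - c) / ε⌋ * ε) = Int.fract ((v - c) / ε) * ε := by
        rw [Int.fract]
        field_simp
        ring
      rw [mem_closedBall, Real.dist_eq, h1, abs_mul, abs_of_pos hε, Int.abs_fract]
      exact mul_le_of_le_one_left hε.le (Int.fract_lt_one _).le
  have hUcard : U.card ≤ t.card * (2 * a + 1) := by
    refine Finset.card_biUnion_le_card_mul _ _ _ fun c _ => Finset.card_image_le.trans ?_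
    rw [Int.card_Icc]
    omega
  calc (coveringNumber ε S : ℝ) ≤ U.card := by exact_mod_cast coveringNumber_le_card U hU
    _ ≤ t.card * (2 * a + 1) := by exact_mod_cast hUcard
    _ ≤ K * (2 * a + 1) := by
      gcongr
      exact h t htS ht

theorem coveringNumber_zero_le_of_packing {A K : ℝ} {S : Set ℝ}
    (h : ∀ ε : ℝ, 0 < ε → ∀ t : Finset ℝ, (t : Set ℝ) ⊆ S →
      (∀ u ∈ t, ∀ v ∈ t, u ≠ v → A * ε < |u - v|) → (t.card : ℝ) ≤ K) :
    (coveringNumber 0 S : ℝ) ≤ K := by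
  have hcard : ∀ t : Finset ℝ, (t : Set ℝ) ⊆ S → (t.card : ℝ) ≤ K := fun t ht => by
    have hlim : ∀ u ∈ t, ∀ v ∈ t, u ≠ v → ∀ᶠ ε in nhdsWithin (0 : ℝ) (Ioi 0), A * ε < |u - v| :=
      fun u _ v _ huv => by
        have hc : ContinuousAt (fun ε : ℝ => A * ε) 0 := by fun_prop
        refine (hc.eventually_lt continuousAt_const ?_).filter_mono nhdsWithin_le_nhds
        simpa [sub_eq_zero] using huv
    have hall : ∀ᶠ ε in nhdsWithin (0 : ℝ) (Ioi 0), ∀ u ∈ t, ∀ v ∈ t, u ≠ v → A * ε < |u - v| := by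
      simp only [Filter.eventually_all_finset, Filter.eventually_imp_distrib_left]
      exact hlim
    obtain ⟨ε, hε, hεpos⟩ := (hall.and self_mem_nhdsWithin).exists
    exact h ε hεpos t ht hε
  have hfin : S.Finite := by
    by_contra hinf
    obtain ⟨t, htS, ht⟩ := Set.Infinite.exists_subset_card_eq hinf (⌊K⌋₊ + 1)
    have h1 := Nat.lt_floor_add_one K
    have h2 := hcard t htS
    rw [ht] at h2
    push_cast at h2
    linarith
  refine le_trans ?_ (hcard hfin.toFinset (by simp))
  refine Nat.cast_le.2 (coveringNumber_le_card _ fun v hv => ?_)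
  exact mem_iUnion₂.2 ⟨v, hfin.mem_toFinset.2 hv, mem_closedBall_self le_rfl⟩

/-- The supremum in the Taylor constant is an upper bound. -/
theorem ContDiffOn.norm_iteratedFDerivWithin_le_iSup {n d : ℕ} {r : ℝ} (hr : 0 < r)
    {f : EuclideanSpace ℝ (Fin n) → ℝ}
    (hf : ContDiffOn ℝ d f (closedBall (0 : EuclideanSpace ℝ (Fin n)) r))
    {x : EuclideanSpace ℝ (Fin n)} (hx : x ∈ closedBall (0 : EuclideanSpace ℝ (Fin n)) r) :
    ‖iteratedFDerivWithin ℝ d f (closedBall (0 : EuclideanSpace ℝ (Fin n)) r) x‖ ≤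
      ⨆ x ∈ closedBall (0 : EuclideanSpace ℝ (Fin n)) r,
        ‖iteratedFDerivWithin ℝ d f (closedBall (0 : EuclideanSpace ℝ (Fin n)) r) x‖ := by
  have huniq : UniqueDiffOn ℝ (closedBall (0 : EuclideanSpace ℝ (Fin n)) r) :=
    uniqueDiffOn_convex (convex_closedBall _ _)
      (by rw [interior_closedBall _ hr.ne']; exact nonempty_ball.2 hr)
  obtain ⟨C, hC⟩ := (isCompact_closedBall _ _).exists_bound_of_continuousOn
    (hf.continuousOn_iteratedFDerivWithin le_rfl huniq)
  have hC0 : 0 ≤ C := (norm_nonneg _).trans (hC x hx)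
  refine le_ciSup_of_le ⟨C, ?_⟩ x ?_
  · rintro _ ⟨y, rfl⟩
    exact Real.iSup_le (fun hy => hC y hy) hC0
  · rw [ciSup_pos hx]

/-- entropy bounds for the set of critical values of a C^d function
on the ball of radius r in ℝ^n. -/
theorem stmt_1 (n d : ℕ) (hn : 1 ≤ n) (hd : 1 ≤ d) :
    ∃ c : ℝ, 0 < c ∧
      ∀ r : ℝ, 0 < r →
        ∀ f : EuclideanSpace ℝ (Fin n) → ℝ,
          ContDiffOn ℝ d f (closedBall (0 : EuclideanSpace ℝ (Fin n)) r) →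
          (∀ ε : ℝ, taylorConst n d r f ≤ ε →
            (coveringNumber ε
              (f '' {x ∈ closedBall (0 : EuclideanSpace ℝ (Fin n)) r |
                fderivWithin ℝ f (closedBall (0 : EuclideanSpace ℝ (Fin n)) r) x = 0}) : ℝ)
              ≤ c) ∧
          (∀ ε : ℝ, 0 < ε → ε ≤ taylorConst n d r f →
            (coveringNumber ε
              (f '' {x ∈ closedBall (0 : EuclideanSpace ℝ (Fin n)) r |
                fderivWithin ℝ f (closedBall (0 : EuclideanSpace ℝ (Fin n)) r) x = 0}) : ℝ)
              ≤ c * (taylorConst n d r f / ε) ^ ((n : ℝ) / d)) := by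
  obtain ⟨d, rfl⟩ : ∃ e, d = e + 1 := ⟨d - 1, by omega⟩
  obtain ⟨C, hC, A, hA, hpack⟩ := exists_critical_packing_bound n d
  set A' : ℝ := A * (d + 1).factorial with hA'
  refine ⟨C * (2 * ⌈A'⌉₊ + 1) + 1, by positivity, fun r hr f hf => ?_⟩
  set M : ℝ := ⨆ x ∈ closedBall (0 : EuclideanSpace ℝ (Fin n)) r,
    ‖iteratedFDerivWithin ℝ (d + 1) f (closedBall (0 : EuclideanSpace ℝ (Fin n)) r) x‖ with hM
  set R : ℝ := taylorConst n (d + 1) r f with hR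
  have hRM : M * r ^ (d + 1) = (d + 1).factorial * R := by
    rw [hR, taylorConst, ← hM]
    have : ((d + 1).factorial : ℝ) ≠ 0 := by positivity
    field_simp
  have hMle : ∀ x ∈ closedBall (0 : EuclideanSpace ℝ (Fin n)) r,
      ‖iteratedFDerivWithin ℝ (d + 1) f (closedBall 0 r) x‖ ≤ M :=
    fun x hx => hf.norm_iteratedFDerivWithin_le_iSup hr hx
  have hM0 : 0 ≤ M := (norm_nonneg _).trans (hMle 0 (mem_closedBall_self hr.le))
  have hR0 : 0 ≤ R := by
    rw [hR, taylorConst]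
    positivity
  have hf' : ContDiffOn ℝ (d + 1) f (closedBall (0 : EuclideanSpace ℝ (Fin n)) r) := by
    exact_mod_cast hf
  have hlarge : ∀ ε : ℝ, 0 < ε → R ≤ ε → ∀ t : Finset ℝ,
      (t : Set ℝ) ⊆ f '' {x ∈ closedBall (0 : EuclideanSpace ℝ (Fin n)) r |
        fderivWithin ℝ f (closedBall (0 : EuclideanSpace ℝ (Fin n)) r) x = 0} →
      (∀ u ∈ t, ∀ v ∈ t, u ≠ v → A' * ε < |u - v|) → (t.card : ℝ) ≤ C := by
    intro ε hε hRε t ht hsep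
    have h := hpack r hr f hf' M hMle r ((d + 1).factorial * ε) hr le_rfl (by positivity)
      (by rw [hRM]; gcongr) t ht (by simpa [hA', mul_assoc] using hsep)
    rwa [div_self hr.ne', one_pow, mul_one] at h
  refine ⟨fun ε hRε => ?_, fun ε hε hεR => ?_⟩
  · rcases (hR0.trans hRε).eq_or_lt with rfl | hε
    · refine (coveringNumber_zero_le_of_packing (A := A') (K := C)
        fun ε hε => hlarge ε hε (hRε.trans hε.le)).trans ?_
      have : 0 ≤ C * (2 * ⌈A'⌉₊) := by positivity
      linarith
    · exact (coveringNumber_le_of_packing hε (hlarge ε hε hRε)).trans (by linarith)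
  · have hRpos : 0 < R := hε.trans_le hεR
    set e : ℝ := (ε / R) ^ (((d + 1 : ℕ) : ℝ)⁻¹) with he
    have hepos : 0 < e := by positivity
    have hepow : e ^ (d + 1) = ε / R := Real.rpow_inv_natCast_pow (by positivity) (by omega)
    have hele : e ≤ 1 :=
      Real.rpow_le_one (by positivity) ((div_le_one hRpos).2 hεR) (by positivity)
    have hpow : (r / (r * e)) ^ n = (R / ε) ^ ((n : ℝ) / (d + 1 : ℕ)) := by
      have h1 : r / (r * e) = (R / ε) ^ (((d + 1 : ℕ) : ℝ)⁻¹) := by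
        rw [div_mul_cancel_left₀ hr.ne', he, ← Real.inv_rpow (by positivity), inv_div]
      rw [h1, ← Real.rpow_mul_natCast (by positivity)]
      congr 1
      rw [div_eq_inv_mul]
    refine (coveringNumber_le_of_packing (A := A') (K := C * (r / (r * e)) ^ n) hε
      fun t ht hsep => ?_).trans ?_
    · refine hpack r hr f hf' M hMle (r * e) ((d + 1).factorial * ε) (by positivity)
        (mul_le_of_le_one_right hr.le hele) (by positivity) (le_of_eq ?_) t ht
        (by simpa [hA', mul_assoc] using hsep)
      rw [mul_pow, ← mul_assoc, hRM, hepow]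
      field_simp
    · rw [hpow]
      have : 0 ≤ (R / ε) ^ ((n : ℝ) / (d + 1 : ℕ)) := by positivity
      linarith
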